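/- Let 1 ≤ α ≤ 3/2, 0 < δ₀ ≤ 1 and C₀ ≥ 1. Let F ⊂ B_{ℝ³}(0,1) be a finite nonempty set and μ the uniform measure on F, and assume μ(B_{ℝ³}(w,δ)) ≤ C₀·δ^α for all w ∈ ℝ³ and all δ ≥ δ₀. Let 0 < ε < α/100. Then there exist constants D ≥ 1 and c > 0 depending only on ε such that for every t ≥ 0 and every δ with e^t·δ₀ ≤ δ ≤ 1, there is a subset 𝓔 = 𝓔_{t,δ} ⊂ [0,1] with |𝓔| ≤ D·δ^{cε} such that: for every r ∈ [0,1] \ 𝓔 there exists F_{t,δ,r} ⊂ F with μ(F \ F_{t,δ,r}) ≤ D·δ^{cε}, and for all w ∈ F_{t,δ,r} one has μ({w' ∈ F_{t,δ,r} : ‖π_{t,r}(w') − π_{t,r}(w)‖ ≤ δ}) ≤ D·C₀·e^{−t/10}·δ^{α−ε}. -/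

import Mathlib

open MeasureTheory Real Metric

noncomputable section

abbrev E3 := EuclideanSpace ℝ (Fin 3)
abbrev E2 := EuclideanSpace ℝ (Fin 2)

/-- The projection `π_{t,r} : ℝ³ → ℝ²`,
`π_{t,r}(x,y,z) = (e^t (x + r y + (r²/2) z), y + r z)`. -/
def piProj (t r : ℝ) (w : E3) : E2 :=
  (EuclideanSpace.equiv (Fin 2) ℝ).symm
    ![Real.exp t * (w 0 + r * w 1 + r ^ 2 / 2 * w 2), w 1 + r * w 2]

/-- The uniform (normalized counting) measure of a set `A` with respect to a finite set `F`. -/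
def mass {V : Type*} (F : Finset V) (A : Set V) : ℝ :=
  (Nat.card ↥(A ∩ (F : Set V)) : ℝ) / F.card

section Incidence

open Finset Classical

variable {V U : Type*}

/-- The sign of the comparison of `x` with `y`. -/
def cmpSign (x y : ℕ) : ℝ := if x < y then 1 else if y < x then -1 else 0

lemma cmpSign_mul_le {x y x' y' : ℕ}
    (h₁ : x < x' → y < y' → x < y → x' < y' → False)
    (h₂ : x < x' → y < y' → y < x → y' < x' → False)
    (h₃ : x' < x → y' < y → x < y → x' < y' → False)
    (h₄ : x' < x → y' < y → y < x → y' < x' → False) :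
    cmpSign x y * cmpSign x' y' ≤ -(cmpSign x x' * cmpSign y y') +
      (if x = y then 1 else 0) + (if x' = y' then 1 else 0) +
      (if x = x' then 1 else 0) + (if y = y' then 1 else 0) := by
  unfold cmpSign
  rcases lt_trichotomy x y with a | a | a <;> rcases lt_trichotomy x' y' with b | b | b <;>
    rcases lt_trichotomy x x' with c | c | c <;> rcases lt_trichotomy y y' with d | d | d <;>
    first
      | (exfalso; omega)
      | (exfalso; exact h₁ c d a b)
      | (exfalso; exact h₂ c d a b)
      | (exfalso; exact h₃ c d a b)
      | (exfalso; exact h₄ c d a b)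
      | (simp only [a, b, c, d, a.ne, a.ne', b.ne, b.ne', c.ne, c.ne', d.ne, d.ne', not_lt_of_gt a,
          not_lt_of_gt b, not_lt_of_gt c, not_lt_of_gt d, if_true, if_false]; norm_num)
      | (subst_vars; simp_all [not_lt_of_gt, ne_of_gt, ne_of_lt]; try norm_num)

end Incidence

section Incidence

open Finset Classical

variable {V U : Type*}

lemma sum_cmpSign_mul_le (K : Finset U) (p p' : U → ℕ) (n r : ℕ)
    (h₁ : ∀ a ∈ K, ∀ b ∈ K, p a < p' a → p b < p' b → p a < p b → p' a < p' b → False)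
    (h₂ : ∀ a ∈ K, ∀ b ∈ K, p' a < p a → p' b < p b → p a < p b → p' a < p' b → False)
    (hn : ∀ j, #{b ∈ K | p b = j} ≤ n) (hn' : ∀ j, #{b ∈ K | p' b = j} ≤ n)
    (hr : #{b ∈ K | p b = p' b} ≤ r) :
    ∑ a ∈ K, ∑ b ∈ K, cmpSign (p a) (p b) * cmpSign (p' a) (p' b) ≤
      -(∑ a ∈ K, cmpSign (p a) (p' a)) ^ 2 + 2 * n * #K + 2 * r * #K := by
  have h0 : ∀ a ∈ K, ∀ b ∈ K, cmpSign (p a) (p b) * cmpSign (p' a) (p' b) ≤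
      -(cmpSign (p a) (p' a) * cmpSign (p b) (p' b)) +
      (if p a = p b then 1 else 0) + (if p' a = p' b then 1 else 0) +
      (if p a = p' a then 1 else 0) + (if p b = p' b then 1 else 0) := fun a ha b hb =>
    cmpSign_mul_le (fun x y z u => h₁ a ha b hb x y z u) (fun x y z u => h₁ b hb a ha y x z u)
      (fun x y z u => h₂ a ha b hb x y z u) (fun x y z u => h₂ b hb a ha y x z u)
  have e1 : ∀ q : U → ℕ, (∀ j, #{b ∈ K | q b = j} ≤ n) →
      ∑ a ∈ K, ∑ b ∈ K, (if q a = q b then (1 : ℝ) else 0) ≤ n * #K := by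
    intro q hq
    rw [mul_comm, ← nsmul_eq_mul]
    refine Finset.sum_le_card_nsmul _ _ _ fun a _ => ?_
    rw [Finset.sum_boole]
    have := hq (q a)
    simp only [eq_comm (a := q a)]
    exact_mod_cast this
  have e2 : ∑ a ∈ K, ∑ b ∈ K, (if p a = p' a then (1 : ℝ) else 0) ≤ r * #K := by
    rw [Finset.sum_comm, mul_comm, ← nsmul_eq_mul]
    refine Finset.sum_le_card_nsmul _ _ _ fun a _ => ?_
    rw [Finset.sum_boole]
    exact_mod_cast hr
  have e3 : ∑ a ∈ K, ∑ b ∈ K, (if p b = p' b then (1 : ℝ) else 0) ≤ r * #K := by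
    rw [Finset.sum_comm]; exact e2
  calc _ ≤ ∑ a ∈ K, ∑ b ∈ K, (-(cmpSign (p a) (p' a) * cmpSign (p b) (p' b)) +
      (if p a = p b then 1 else 0) + (if p' a = p' b then 1 else 0) +
      (if p a = p' a then 1 else 0) + (if p b = p' b then 1 else 0)) :=
        Finset.sum_le_sum fun a ha => Finset.sum_le_sum fun b hb => h0 a ha b hb
    _ ≤ _ := by
        simp only [Finset.sum_add_distrib, Finset.sum_neg_distrib, ← Finset.sum_mul_sum]
        have := e1 p hn
        have := e1 p' hn'
        nlinarith

lemma neg_sum_mul_le_half_sum_sq (u : ℕ → ℝ) (H : ℕ) :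
    -∑ m ∈ range H, u (2 * m) * u (2 * m + 1) ≤ 1 / 2 * ∑ h ∈ range (2 * H), u h ^ 2 := by
  induction H with
  | zero => simp
  | succ k ih =>
    rw [Finset.sum_range_succ, show 2 * (k + 1) = 2 * k + 1 + 1 by ring,
      Finset.sum_range_succ _ (2 * k + 1), Finset.sum_range_succ _ (2 * k)]
    nlinarith [sq_nonneg (u (2 * k) + u (2 * k + 1))]

lemma exists_div_two_pow {x y ℓ : ℕ} (hxy : x < y) (hy : y < 2 ^ ℓ) :
    ∃ i < ℓ, ∃ m, x / 2 ^ i = 2 * m ∧ y / 2 ^ i = 2 * m + 1 := by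
  have hex : ∃ i, x / 2 ^ i = y / 2 ^ i :=
    ⟨ℓ, by rw [Nat.div_eq_of_lt hy, Nat.div_eq_of_lt (hxy.trans hy)]⟩
  have hle : Nat.find hex ≤ ℓ :=
    Nat.find_min' hex (by rw [Nat.div_eq_of_lt hy, Nat.div_eq_of_lt (hxy.trans hy)])
  have hsp := Nat.find_spec hex
  obtain ⟨i, hi⟩ : ∃ i, Nat.find hex = i + 1 := by
    refine Nat.exists_eq_succ_of_ne_zero fun h => ?_
    rw [h] at hsp
    simp at hsp
    omega
  have hne := Nat.find_min hex (m := i) (by omega)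
  rw [hi, pow_succ, ← Nat.div_div_eq_div_mul, ← Nat.div_div_eq_div_mul] at hsp
  have hmono : x / 2 ^ i ≤ y / 2 ^ i := Nat.div_le_div_right hxy.le
  exact ⟨i, by omega, x / 2 ^ i / 2, by omega, by omega⟩

end Incidence

section Incidence

open Finset Classical

variable {V U : Type*}

/-- A relation `E` between `W` and `B` with labels `p`, such that two elements of `W` are never
joined to the same pair of elements of `B` with labels in certain relative positions. -/
structure IsOrderedIncidence (W : Finset V) (B : Finset U) (E : V → U → Prop) (p : V → U → ℕ)
    (n : ℕ) : Prop where
  card_le : ∀ w ∈ W, ∀ j, #{b ∈ B | E w b ∧ p w b = j} ≤ n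
  not_parallel : ∀ w ∈ W, ∀ w' ∈ W, ∀ a ∈ B, ∀ b ∈ B, E w a → E w' a → E w b → E w' b →
    p w a < p w' a → p w b < p w' b → p w a < p w b → p w' a < p w' b → False
  not_separated : ∀ w ∈ W, ∀ w' ∈ W, ∀ a ∈ B, ∀ b ∈ B, E w a → E w' a → E w b → E w' b →
    p w a < p w' a → p w b < p w' b → p w' a < p w b → False

variable {W : Finset V} {B : Finset U} {E : V → U → Prop} {p : V → U → ℕ} {n : ℕ}

/-- The common neighbours of `w` and `w'` whose labels lie in the two halves of a dyadic block. -/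
def halfBlock (B : Finset U) (E : V → U → Prop) (p : V → U → ℕ) (i : ℕ) (w w' : V) : Finset U :=
  {a ∈ B | E w a ∧ E w' a ∧ ∃ m, p w a / 2 ^ i = 2 * m ∧ p w' a / 2 ^ i = 2 * m + 1}

/-- The comparison sign of the labels at `w` of `a` and `b` if these lie in the dyadic block `h`. -/
def blockSign (E : V → U → Prop) (p : V → U → ℕ) (i h : ℕ) (w : V) (a b : U) : ℝ :=
  if E w a ∧ E w b ∧ p w a / 2 ^ i = h ∧ p w b / 2 ^ i = h then cmpSign (p w a) (p w b) else 0

lemma IsOrderedIncidence.div_eq (hI : IsOrderedIncidence W B E p n) {i : ℕ} {w w' : V}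
    (hw : w ∈ W) (hw' : w' ∈ W) {a b : U} (ha : a ∈ halfBlock B E p i w w')
    (hb : b ∈ halfBlock B E p i w w') : p w a / 2 ^ i ≤ p w b / 2 ^ i := by
  simp only [halfBlock, mem_filter] at ha hb
  obtain ⟨haB, ea, ea', m, h1, h2⟩ := ha
  obtain ⟨hbB, eb, eb', m', h3, h4⟩ := hb
  by_contra hlt
  push Not at hlt
  have l1 : p w a < p w' a := lt_of_not_ge fun h => by
    have := Nat.div_le_div_right (c := 2 ^ i) h; omega
  have l2 : p w b < p w' b := lt_of_not_ge fun h => by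
    have := Nat.div_le_div_right (c := 2 ^ i) h; omega
  have l3 : p w' b < p w a := lt_of_not_ge fun h => by
    have := Nat.div_le_div_right (c := 2 ^ i) h; omega
  exact hI.not_separated w hw w' hw' b hbB a haB eb eb' ea ea' l2 l1 l3

lemma sum_halfBlock (hI : IsOrderedIncidence W B E p n) {i H : ℕ} {w w' : V}
    (hw : w ∈ W) (hw' : w' ∈ W) (hp : ∀ b, p w b < H) :
    ∑ a ∈ B, ∑ b ∈ B, ∑ m ∈ range H,
        blockSign E p i (2 * m) w a b * blockSign E p i (2 * m + 1) w' a b =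
      ∑ a ∈ halfBlock B E p i w w', ∑ b ∈ halfBlock B E p i w w',
        cmpSign (p w a) (p w b) * cmpSign (p w' a) (p w' b) := by
  have key : ∀ a ∈ B, ∀ b ∈ B, ∑ m ∈ range H,
        blockSign E p i (2 * m) w a b * blockSign E p i (2 * m + 1) w' a b =
      if a ∈ halfBlock B E p i w w' then (if b ∈ halfBlock B E p i w w' then
        cmpSign (p w a) (p w b) * cmpSign (p w' a) (p w' b) else 0) else 0 := by
    intro a ha b hb
    by_cases hab : a ∈ halfBlock B E p i w w' ∧ b ∈ halfBlock B E p i w w'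
    · obtain ⟨h1, h2⟩ := hab
      have e := le_antisymm (hI.div_eq hw hw' h1 h2) (hI.div_eq hw hw' h2 h1)
      rw [if_pos h1, if_pos h2]
      simp only [halfBlock, mem_filter] at h1 h2
      obtain ⟨haB, ea, ea', m, h11, h12⟩ := h1
      obtain ⟨hbB, eb, eb', m', h21, h22⟩ := h2
      obtain rfl : m = m' := by omega
      have hm : m ∈ range H := by
        have := Nat.div_le_self (p w a) (2 ^ i)
        have := hp a
        rw [mem_range]; omega
      rw [Finset.sum_eq_single_of_mem m hm]
      · simp [blockSign, *]
      · intro m' _ hne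
        rw [blockSign, if_neg (by rintro ⟨-, -, h, -⟩; omega), zero_mul]
    · have : ∀ m ∈ range H,
          blockSign E p i (2 * m) w a b * blockSign E p i (2 * m + 1) w' a b = 0 := by
        intro m _
        by_contra hne
        apply hab
        rw [mul_eq_zero, not_or] at hne
        unfold blockSign at hne
        obtain ⟨h1, h2⟩ := hne
        have h1' := of_not_not fun h => h1 (if_neg h)
        have h2' := of_not_not fun h => h2 (if_neg h)
        simp only [halfBlock, mem_filter]
        exact ⟨⟨ha, h1'.1, h2'.1, m, h1'.2.2.1, h2'.2.2.1⟩,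
          ⟨hb, h1'.2.1, h2'.2.1, m, h1'.2.2.2, h2'.2.2.2⟩⟩
      rw [Finset.sum_eq_zero this]
      split_ifs with h1 h2
      · exact absurd ⟨h1, h2⟩ hab
      · rfl
      · rfl
  rw [Finset.sum_congr rfl fun a ha => Finset.sum_congr rfl fun b hb => key a ha b hb]
  have hsub : halfBlock B E p i w w' ⊆ B := Finset.filter_subset _ _
  have hin : ∀ g : U → ℝ, ∑ b ∈ B, (if b ∈ halfBlock B E p i w w' then g b else 0) =
      ∑ b ∈ halfBlock B E p i w w', g b := fun g => by
    rw [← Finset.sum_filter, Finset.filter_mem_eq_inter, Finset.inter_eq_right.2 hsub]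
  rw [← hin]
  refine Finset.sum_congr rfl fun a _ => ?_
  split_ifs
  · exact hin _
  · simp

lemma sum_blockSign_le (hI : IsOrderedIncidence W B E p n) (i H : ℕ) {w w' : V}
    (hw : w ∈ W) (hw' : w' ∈ W) :
    ∑ h ∈ range H, ∑ a ∈ B, ∑ b ∈ B, blockSign E p i h w a b * blockSign E p i h w' a b ≤
      2 * (n + #{b ∈ B | E w b ∧ E w' b ∧ p w b = p w' b}) * #{b ∈ B | E w b ∧ E w' b} := by
  set K : ℕ → Finset U := fun h =>
    {a ∈ B | (E w a ∧ E w' a) ∧ p w a / 2 ^ i = h ∧ p w' a / 2 ^ i = h} with hK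
  set r := #{b ∈ B | E w b ∧ E w' b ∧ p w b = p w' b}
  have hsub : ∀ h, K h ⊆ B := fun h => Finset.filter_subset _ _
  have h1 : ∀ h, ∑ a ∈ B, ∑ b ∈ B, blockSign E p i h w a b * blockSign E p i h w' a b =
      ∑ a ∈ K h, ∑ b ∈ K h, cmpSign (p w a) (p w b) * cmpSign (p w' a) (p w' b) := by
    intro h
    have hin : ∀ g : U → ℝ, ∑ b ∈ B, (if b ∈ K h then g b else 0) = ∑ b ∈ K h, g b := fun g => by
      rw [← Finset.sum_filter, Finset.filter_mem_eq_inter, Finset.inter_eq_right.2 (hsub h)]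
    rw [← hin]
    refine Finset.sum_congr rfl fun a ha => ?_
    by_cases hak : a ∈ K h
    · rw [if_pos hak, ← hin]
      refine Finset.sum_congr rfl fun b hb => ?_
      simp only [hK, mem_filter] at hak ⊢
      by_cases hbk : b ∈ B ∧ (E w b ∧ E w' b) ∧ p w b / 2 ^ i = h ∧ p w' b / 2 ^ i = h
      · rw [if_pos hbk]; simp [blockSign, hak.2.1, hak.2.2, hbk.2.1, hbk.2.2]
      · rw [if_neg hbk, blockSign, blockSign, ite_zero_mul_ite_zero, if_neg]
        rintro ⟨h1, h2⟩
        exact hbk ⟨hb, ⟨h1.2.1, h2.2.1⟩, h1.2.2.2, h2.2.2.2⟩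
    · rw [if_neg hak]
      refine Finset.sum_eq_zero fun b hb => ?_
      rw [blockSign, blockSign, ite_zero_mul_ite_zero, if_neg]
      rintro ⟨h1, h2⟩
      refine hak ?_
      simp only [hK, mem_filter]
      exact ⟨ha, ⟨h1.1, h2.1⟩, h1.2.2.1, h2.2.2.1⟩
  have h2 : ∀ h, ∑ a ∈ K h, ∑ b ∈ K h, cmpSign (p w a) (p w b) * cmpSign (p w' a) (p w' b) ≤
      2 * (n + r) * #(K h) := by
    intro h
    have hmem : ∀ a ∈ K h, a ∈ B ∧ E w a ∧ E w' a := fun a ha => by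
      simp only [hK, mem_filter] at ha; exact ⟨ha.1, ha.2.1⟩
    have := sum_cmpSign_mul_le (K h) (p w) (p w') n r
      (fun a ha b hb => hI.not_parallel w hw w' hw' a (hmem a ha).1 b (hmem b hb).1
        (hmem a ha).2.1 (hmem a ha).2.2 (hmem b hb).2.1 (hmem b hb).2.2)
      (fun a ha b hb x y z u => hI.not_parallel w' hw' w hw a (hmem a ha).1 b (hmem b hb).1
        (hmem a ha).2.2 (hmem a ha).2.1 (hmem b hb).2.2 (hmem b hb).2.1 x y u z)
      (fun j => (card_le_card fun b hb => by
        simp only [mem_filter] at hb ⊢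
        exact ⟨(hmem b hb.1).1, (hmem b hb.1).2.1, hb.2⟩).trans (hI.card_le w hw j))
      (fun j => (card_le_card fun b hb => by
        simp only [mem_filter] at hb ⊢
        exact ⟨(hmem b hb.1).1, (hmem b hb.1).2.2, hb.2⟩).trans (hI.card_le w' hw' j))
      (card_le_card fun b hb => by
        simp only [mem_filter] at hb ⊢
        exact ⟨(hmem b hb.1).1, (hmem b hb.1).2.1, (hmem b hb.1).2.2, hb.2⟩)
    nlinarith [sq_nonneg (∑ a ∈ K h, cmpSign (p w a) (p w' a))]
  have h3 : ∑ h ∈ range H, #(K h) ≤ #{b ∈ B | E w b ∧ E w' b} := by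
    rw [← Finset.card_biUnion]
    · refine card_le_card fun b hb => ?_
      simp only [hK, mem_biUnion, mem_filter] at hb ⊢
      obtain ⟨_, _, h⟩ := hb
      exact ⟨h.1, h.2.1⟩
    · intro x _ y _ hxy
      rw [Function.onFun, Finset.disjoint_left]
      intro a ha hb
      simp only [hK, mem_filter] at ha hb
      exact hxy (ha.2.2.1.symm.trans hb.2.2.1)
  calc _ ≤ ∑ h ∈ range H, (2 * (n + r) * #(K h) : ℝ) :=
        Finset.sum_le_sum fun h _ => (h1 h).le.trans (h2 h)
    _ = 2 * (n + r) * ((∑ h ∈ range H, #(K h) : ℕ) : ℝ) := by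
        rw [← Finset.mul_sum]; push_cast; rfl
    _ ≤ _ := by gcongr

lemma sum_halfBlock_sq_le (hI : IsOrderedIncidence W B E p n) (i : ℕ) {H : ℕ}
    (hp : ∀ w b, p w b < H) :
    ∑ w ∈ W, ∑ w' ∈ W, ((#(halfBlock B E p i w w') : ℝ) ^ 2 - 2 * n * #(halfBlock B E p i w w')) ≤
      ∑ w ∈ W, ∑ w' ∈ W, ((n : ℝ) + #{b ∈ B | E w b ∧ E w' b ∧ p w b = p w' b}) *
        #{b ∈ B | E w b ∧ E w' b} := by
  have h1 : ∀ w ∈ W, ∀ w' ∈ W,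
      (#(halfBlock B E p i w w') : ℝ) ^ 2 - 2 * n * #(halfBlock B E p i w w') ≤
      -∑ a ∈ B, ∑ b ∈ B, ∑ m ∈ range H,
        blockSign E p i (2 * m) w a b * blockSign E p i (2 * m + 1) w' a b := by
    intro w hw w' hw'
    rw [sum_halfBlock hI hw hw' (hp w)]
    have hmem : ∀ a ∈ halfBlock B E p i w w', a ∈ B ∧ E w a ∧ E w' a := fun a ha => by
      simp only [halfBlock, mem_filter] at ha; exact ⟨ha.1, ha.2.1, ha.2.2.1⟩
    have hlt : ∀ a ∈ halfBlock B E p i w w', p w a < p w' a := fun a ha => by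
      simp only [halfBlock, mem_filter] at ha
      obtain ⟨-, -, -, m, h1, h2⟩ := ha
      refine lt_of_not_ge fun h => ?_
      have := Nat.div_le_div_right (c := 2 ^ i) h; omega
    have := sum_cmpSign_mul_le (halfBlock B E p i w w') (p w) (p w') n 0
      (fun a ha b hb => hI.not_parallel w hw w' hw' a (hmem a ha).1 b (hmem b hb).1
        (hmem a ha).2.1 (hmem a ha).2.2 (hmem b hb).2.1 (hmem b hb).2.2)
      (fun a ha b hb x y z u => hI.not_parallel w' hw' w hw a (hmem a ha).1 b (hmem b hb).1
        (hmem a ha).2.2 (hmem a ha).2.1 (hmem b hb).2.2 (hmem b hb).2.1 x y u z)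
      (fun j => (card_le_card fun b hb => by
        simp only [mem_filter] at hb ⊢
        exact ⟨(hmem b hb.1).1, (hmem b hb.1).2.1, hb.2⟩).trans (hI.card_le w hw j))
      (fun j => (card_le_card fun b hb => by
        simp only [mem_filter] at hb ⊢
        exact ⟨(hmem b hb.1).1, (hmem b hb.1).2.2, hb.2⟩).trans (hI.card_le w' hw' j))
      (by rw [Finset.filter_eq_empty_iff.2 fun a ha => (hlt a ha).ne]; simp)
    rw [Finset.sum_congr rfl fun a ha => show cmpSign (p w a) (p w' a) = 1 by
      simp [cmpSign, hlt a ha]] at this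
    simp at this
    linarith
  have h2 : ∀ a b, -∑ m ∈ range H, (∑ w ∈ W, blockSign E p i (2 * m) w a b) *
      (∑ w ∈ W, blockSign E p i (2 * m + 1) w a b) ≤
      1 / 2 * ∑ h ∈ range (2 * H), (∑ w ∈ W, blockSign E p i h w a b) ^ 2 := fun a b =>
    neg_sum_mul_le_half_sum_sq (fun h => ∑ w ∈ W, blockSign E p i h w a b) H
  have comm : ∀ (g : V → V → U → U → ℕ → ℝ) (H : ℕ),
      ∑ w ∈ W, ∑ w' ∈ W, ∑ a ∈ B, ∑ b ∈ B, ∑ m ∈ range H, g w w' a b m =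
      ∑ a ∈ B, ∑ b ∈ B, ∑ m ∈ range H, ∑ w ∈ W, ∑ w' ∈ W, g w w' a b m := by
    have c1 : ∀ (g : V → U → U → ℕ → ℝ) (H : ℕ),
        ∑ w ∈ W, ∑ a ∈ B, ∑ b ∈ B, ∑ m ∈ range H, g w a b m =
        ∑ a ∈ B, ∑ b ∈ B, ∑ m ∈ range H, ∑ w ∈ W, g w a b m := by
      intro g H
      rw [Finset.sum_comm]
      refine Finset.sum_congr rfl fun a _ => ?_
      rw [Finset.sum_comm]
      refine Finset.sum_congr rfl fun b _ => ?_
      rw [Finset.sum_comm]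
    intro g H
    rw [Finset.sum_congr rfl fun w _ => c1 (g w) H]
    exact c1 (fun w a b m => ∑ w' ∈ W, g w w' a b m) H
  calc _ ≤ ∑ w ∈ W, ∑ w' ∈ W, -∑ a ∈ B, ∑ b ∈ B, ∑ m ∈ range H,
        blockSign E p i (2 * m) w a b * blockSign E p i (2 * m + 1) w' a b :=
        Finset.sum_le_sum fun w hw => Finset.sum_le_sum fun w' hw' => h1 w hw w' hw'
    _ = ∑ a ∈ B, ∑ b ∈ B, -∑ m ∈ range H, (∑ w ∈ W, blockSign E p i (2 * m) w a b) *
      (∑ w ∈ W, blockSign E p i (2 * m + 1) w a b) := by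
        simp only [Finset.sum_neg_distrib, Finset.sum_mul_sum]
        rw [comm (fun w w' a b m => blockSign E p i (2 * m) w a b *
          blockSign E p i (2 * m + 1) w' a b)]
    _ ≤ ∑ a ∈ B, ∑ b ∈ B, 1 / 2 * ∑ h ∈ range (2 * H), (∑ w ∈ W, blockSign E p i h w a b) ^ 2 :=
        Finset.sum_le_sum fun a _ => Finset.sum_le_sum fun b _ => h2 a b
    _ = 1 / 2 * ∑ w ∈ W, ∑ w' ∈ W, ∑ a ∈ B, ∑ b ∈ B, ∑ h ∈ range (2 * H),
        blockSign E p i h w a b * blockSign E p i h w' a b := by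
        rw [comm (fun w w' a b h => blockSign E p i h w a b * blockSign E p i h w' a b)]
        simp only [sq, Finset.sum_mul_sum]
        simp only [Finset.mul_sum]
    _ = 1 / 2 * ∑ w ∈ W, ∑ w' ∈ W, ∑ h ∈ range (2 * H), ∑ a ∈ B, ∑ b ∈ B,
        blockSign E p i h w a b * blockSign E p i h w' a b := by
        congr 1
        refine Finset.sum_congr rfl fun w _ => Finset.sum_congr rfl fun w' _ => ?_
        rw [Finset.sum_comm, Finset.sum_comm (s := range (2 * H))]
        rw [Finset.sum_comm]
        refine Finset.sum_congr rfl fun a _ => ?_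
        rw [Finset.sum_comm]
    _ ≤ 1 / 2 * ∑ w ∈ W, ∑ w' ∈ W, 2 * ((n : ℝ) +
        #{b ∈ B | E w b ∧ E w' b ∧ p w b = p w' b}) * #{b ∈ B | E w b ∧ E w' b} := by
        gcongr with w hw w' hw'
        exact sum_blockSign_le hI i (2 * H) hw hw'
    _ = _ := by
        simp only [Finset.mul_sum]
        refine Finset.sum_congr rfl fun w _ => Finset.sum_congr rfl fun w' _ => ?_
        ring

end Incidence

section Incidence

open Finset Classical

variable {V U : Type*}

variable {W : Finset V} {B : Finset U} {E : V → U → Prop} {p : V → U → ℕ} {n : ℕ}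

lemma sum_card_lt_sq_le (hI : IsOrderedIncidence W B E p n) {ℓ : ℕ} (hp : ∀ w b, p w b < 2 ^ ℓ) :
    ∑ w ∈ W, ∑ w' ∈ W, (#{b ∈ B | E w b ∧ E w' b ∧ p w b < p w' b} : ℝ) ^ 2 ≤
      3 * ℓ ^ 2 * ∑ w ∈ W, ∑ w' ∈ W, ((n : ℝ) + #{b ∈ B | E w b ∧ E w' b ∧ p w b = p w' b}) *
        #{b ∈ B | E w b ∧ E w' b} := by
  set k : V → V → ℝ := fun w w' => #{b ∈ B | E w b ∧ E w' b} with hk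
  set r : V → V → ℝ := fun w w' => #{b ∈ B | E w b ∧ E w' b ∧ p w b = p w' b} with hr
  have h1 : ∀ w w', (#{b ∈ B | E w b ∧ E w' b ∧ p w b < p w' b} : ℝ) ≤
      ∑ i ∈ range ℓ, (#(halfBlock B E p i w w') : ℝ) := by
    intro w w'
    rw [← Nat.cast_sum]
    norm_cast
    refine le_trans (card_le_card fun b hb => ?_) card_biUnion_le
    simp only [mem_filter, mem_biUnion, halfBlock, mem_range] at hb ⊢
    obtain ⟨i, hi, hm⟩ := exists_div_two_pow hb.2.2.2 (hp w' b)
    exact ⟨i, hi, hb.1, hb.2.1, hb.2.2.1, hm⟩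
  have h2 : ∀ w w', (#{b ∈ B | E w b ∧ E w' b ∧ p w b < p w' b} : ℝ) ^ 2 ≤
      ℓ * ∑ i ∈ range ℓ, (#(halfBlock B E p i w w') : ℝ) ^ 2 := by
    intro w w'
    calc _ ≤ (∑ i ∈ range ℓ, (#(halfBlock B E p i w w') : ℝ)) ^ 2 := by
          gcongr; exact h1 w w'
      _ ≤ _ := by
          have := sq_sum_le_card_mul_sum_sq (s := range ℓ)
            (f := fun i => (#(halfBlock B E p i w w') : ℝ))
          simpa using this
  have h3 : ∀ i, ∑ w ∈ W, ∑ w' ∈ W, (#(halfBlock B E p i w w') : ℝ) ^ 2 ≤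
      3 * ∑ w ∈ W, ∑ w' ∈ W, ((n : ℝ) + r w w') * k w w' := by
    intro i
    have := sum_halfBlock_sq_le hI i hp
    simp only [Finset.sum_sub_distrib] at this
    have h4 : ∑ w ∈ W, ∑ w' ∈ W, 2 * (n : ℝ) * #(halfBlock B E p i w w') ≤
        ∑ w ∈ W, ∑ w' ∈ W, 2 * (((n : ℝ) + r w w') * k w w') := by
      refine Finset.sum_le_sum fun w _ => Finset.sum_le_sum fun w' _ => ?_
      have a1 : (#(halfBlock B E p i w w') : ℝ) ≤ k w w' := by
        simp only [hk]
        norm_cast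
        refine card_le_card fun b hb => ?_
        simp only [halfBlock, mem_filter] at hb ⊢
        exact ⟨hb.1, hb.2.1, hb.2.2.1⟩
      have a2 : 0 ≤ r w w' := by simp [hr]
      have a3 : 0 ≤ k w w' := by simp [hk]
      have a4 : (0 : ℝ) ≤ n := by positivity
      nlinarith [mul_nonneg a2 a3, mul_le_mul_of_nonneg_left a1 a4]
    simp only [← Finset.mul_sum] at h4 this
    linarith
  calc _ ≤ ∑ w ∈ W, ∑ w' ∈ W, ℓ * ∑ i ∈ range ℓ, (#(halfBlock B E p i w w') : ℝ) ^ 2 := by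
        gcongr; exact h2 _ _
    _ = ℓ * ∑ i ∈ range ℓ, ∑ w ∈ W, ∑ w' ∈ W, (#(halfBlock B E p i w w') : ℝ) ^ 2 := by
        rw [Finset.sum_comm (s := range ℓ)]
        simp only [← Finset.mul_sum]
        congr 1
        refine Finset.sum_congr rfl fun w _ => ?_
        rw [Finset.sum_comm (s := range ℓ)]
    _ ≤ ℓ * ∑ i ∈ range ℓ, 3 * ∑ w ∈ W, ∑ w' ∈ W, ((n : ℝ) + r w w') * k w w' := by
        gcongr; exact h3 _
    _ = _ := by
        simp only [Finset.sum_const, card_range, nsmul_eq_mul]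
        ring

lemma sum_sum_sq_le {k r : V → V → ℝ} {N : V → V → ℝ} {m ℓ : ℝ} (hm : 1 ≤ m) (hℓ : 1 ≤ ℓ)
    (hr : ∀ w ∈ W, ∀ w' ∈ W, r w w' ≤ m * N w w') (hr0 : ∀ w w', 0 ≤ r w w')
    (h : ∑ w ∈ W, ∑ w' ∈ W, k w w' ^ 2 ≤ 3 * ∑ w ∈ W, ∑ w' ∈ W, r w w' ^ 2 +
      18 * ℓ ^ 2 * ∑ w ∈ W, ∑ w' ∈ W, (m + r w w') * k w w') :
    ∑ w ∈ W, ∑ w' ∈ W, k w w' ≤ 655 * ℓ ^ 4 * m * ∑ w ∈ W, ∑ w' ∈ W, (1 + N w w' ^ 2) := by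
  have e1 : ∑ w ∈ W, ∑ w' ∈ W, 18 * ℓ ^ 2 * ((m + r w w') * k w w') ≤
      ∑ w ∈ W, ∑ w' ∈ W, (1 / 2 * k w w' ^ 2 + 162 * ℓ ^ 4 * (m + r w w') ^ 2) := by
    gcongr with w _ w' _
    nlinarith [sq_nonneg (k w w' - 18 * ℓ ^ 2 * (m + r w w'))]
  have e2 : ∑ w ∈ W, ∑ w' ∈ W, (3 * r w w' ^ 2 + 162 * ℓ ^ 4 * (m + r w w') ^ 2) ≤
      ∑ w ∈ W, ∑ w' ∈ W, 327 * ℓ ^ 4 * m ^ 2 * (1 + N w w' ^ 2) := by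
    refine Finset.sum_le_sum fun w hw => Finset.sum_le_sum fun w' hw' => ?_
    have h1 : r w w' ^ 2 ≤ m ^ 2 * N w w' ^ 2 := by
      rw [← mul_pow]
      exact pow_le_pow_left₀ (hr0 w w') (hr w hw w' hw') 2
    have h2 : (m + r w w') ^ 2 ≤ 2 * (m ^ 2 * (1 + N w w' ^ 2)) := by
      nlinarith [sq_nonneg (m - r w w')]
    have h3 : 1 ≤ ℓ ^ 4 := one_le_pow₀ hℓ
    have h4 : 0 ≤ m ^ 2 * (1 + N w w' ^ 2) := by positivity
    calc 3 * r w w' ^ 2 + 162 * ℓ ^ 4 * (m + r w w') ^ 2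
        ≤ 3 * (1 * (m ^ 2 * (1 + N w w' ^ 2))) +
          162 * ℓ ^ 4 * (2 * (m ^ 2 * (1 + N w w' ^ 2))) := by
          gcongr; nlinarith [sq_nonneg m]
      _ ≤ 3 * (ℓ ^ 4 * (m ^ 2 * (1 + N w w' ^ 2))) +
          162 * ℓ ^ 4 * (2 * (m ^ 2 * (1 + N w w' ^ 2))) := by gcongr
      _ = _ := by ring
  have e3 : ∑ w ∈ W, ∑ w' ∈ W, m * k w w' ≤
      ∑ w ∈ W, ∑ w' ∈ W, (k w w' ^ 2 + ℓ ^ 4 * m ^ 2 * (1 + N w w' ^ 2)) := by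
    refine Finset.sum_le_sum fun w hw => Finset.sum_le_sum fun w' hw' => ?_
    have h3 : 1 ≤ ℓ ^ 4 := one_le_pow₀ hℓ
    have : m ^ 2 ≤ ℓ ^ 4 * m ^ 2 * (1 + N w w' ^ 2) := by
      have h5 : m ^ 2 ≤ ℓ ^ 4 * m ^ 2 := le_mul_of_one_le_left (by positivity) h3
      exact h5.trans (le_mul_of_one_le_right (by positivity) (by nlinarith [sq_nonneg (N w w')]))
    nlinarith [sq_nonneg (m - k w w'), sq_nonneg m, sq_nonneg (k w w')]
  simp only [Finset.sum_add_distrib, ← Finset.mul_sum] at e1 e2 e3 ⊢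
  have key : m * ∑ w ∈ W, ∑ w' ∈ W, k w w' ≤ m * (655 * ℓ ^ 4 * m *
      (∑ w ∈ W, ∑ w' ∈ W, 1 + ∑ w ∈ W, ∑ w' ∈ W, N w w' ^ 2)) := by
    nlinarith
  exact le_of_mul_le_mul_left key (by linarith)

theorem IsOrderedIncidence.sq_sum_card_le (hI : IsOrderedIncidence W B E p n) {ℓ : ℕ}
    (hp : ∀ w b, p w b < 2 ^ ℓ) (hn : 1 ≤ n) (hℓ : 1 ≤ ℓ) {N : V → V → ℝ}
    (hN : ∀ w ∈ W, ∀ w' ∈ W, (#{b ∈ B | E w b ∧ E w' b ∧ p w b = p w' b} : ℝ) ≤ n * N w w') :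
    (∑ w ∈ W, (#{b ∈ B | E w b} : ℝ)) ^ 2 ≤
      655 * ℓ ^ 4 * n * #B * ∑ w ∈ W, ∑ w' ∈ W, (1 + N w w' ^ 2) := by
  have h0 := sum_card_lt_sq_le hI hp
  have h1 : ∑ w ∈ W, ∑ w' ∈ W, (#{b ∈ B | E w b ∧ E w' b} : ℝ) ^ 2 ≤
      3 * ∑ w ∈ W, ∑ w' ∈ W, (#{b ∈ B | E w b ∧ E w' b ∧ p w b = p w' b} : ℝ) ^ 2 +
      18 * (ℓ : ℝ) ^ 2 * ∑ w ∈ W, ∑ w' ∈ W,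
        ((n : ℝ) + #{b ∈ B | E w b ∧ E w' b ∧ p w b = p w' b}) *
        #{b ∈ B | E w b ∧ E w' b} := by
    have h2 : ∀ w w', (#{b ∈ B | E w b ∧ E w' b} : ℝ) ^ 2 ≤
        3 * ((#{b ∈ B | E w b ∧ E w' b ∧ p w b = p w' b} : ℝ) ^ 2 +
        (#{b ∈ B | E w b ∧ E w' b ∧ p w b < p w' b} : ℝ) ^ 2 +
        (#{b ∈ B | E w' b ∧ E w b ∧ p w' b < p w b} : ℝ) ^ 2) := by
      intro w w'
      have : (#{b ∈ B | E w b ∧ E w' b} : ℝ) ≤ #{b ∈ B | E w b ∧ E w' b ∧ p w b = p w' b} +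
          #{b ∈ B | E w b ∧ E w' b ∧ p w b < p w' b} +
          #{b ∈ B | E w' b ∧ E w b ∧ p w' b < p w b} := by
        norm_cast
        refine le_trans (card_le_card fun b hb => ?_)
          ((card_union_le _ _).trans (Nat.add_le_add_right (card_union_le _ _) _))
        simp only [mem_filter, mem_union] at hb ⊢
        rcases lt_trichotomy (p w b) (p w' b) with h | h | h <;> tauto
      refine (pow_le_pow_left₀ (by positivity) this 2).trans ?_
      generalize (#{b ∈ B | E w b ∧ E w' b ∧ p w b = p w' b} : ℝ) = x
      generalize (#{b ∈ B | E w b ∧ E w' b ∧ p w b < p w' b} : ℝ) = y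
      generalize (#{b ∈ B | E w' b ∧ E w b ∧ p w' b < p w b} : ℝ) = z
      nlinarith [sq_nonneg (x - y), sq_nonneg (y - z), sq_nonneg (x - z)]
    have h3 := Finset.sum_le_sum fun w (_ : w ∈ W) =>
      Finset.sum_le_sum fun w' (_ : w' ∈ W) => h2 w w'
    simp only [Finset.sum_add_distrib, ← Finset.mul_sum] at h3
    have h4 : ∑ w ∈ W, ∑ w' ∈ W, (#{b ∈ B | E w' b ∧ E w b ∧ p w' b < p w b} : ℝ) ^ 2 =
      ∑ w ∈ W, ∑ w' ∈ W, (#{b ∈ B | E w b ∧ E w' b ∧ p w b < p w' b} : ℝ) ^ 2 :=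
      Finset.sum_comm
    linarith
  have h2 := sum_sum_sq_le (N := N) (m := n) (ℓ := ℓ) (by exact_mod_cast hn)
    (by exact_mod_cast hℓ) hN (fun _ _ => by positivity) h1
  have h3 : (∑ w ∈ W, (#{b ∈ B | E w b} : ℝ)) = ∑ b ∈ B, (#{w ∈ W | E w b} : ℝ) := by
    simp only [← Finset.sum_boole]
    exact Finset.sum_comm
  have h4 : ∑ b ∈ B, (#{w ∈ W | E w b} : ℝ) ^ 2 =
      ∑ w ∈ W, ∑ w' ∈ W, (#{b ∈ B | E w b ∧ E w' b} : ℝ) := by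
    simp only [← Finset.sum_boole, sq, Finset.sum_mul_sum, ite_zero_mul_ite_zero, one_mul]
    rw [Finset.sum_comm]
    exact Finset.sum_congr rfl fun _ _ => Finset.sum_comm
  rw [h3]
  refine sq_sum_le_card_mul_sum_sq.trans ?_
  rw [h4]
  calc _ ≤ (#B : ℝ) * (655 * ℓ ^ 4 * n * ∑ w ∈ W, ∑ w' ∈ W, (1 + N w w' ^ 2)) := by gcongr
    _ = _ := by ring

end Incidence

/-- The first coordinate of the projection at time zero, as a function of `r`. -/
def curve (v : E3) (r : ℝ) : ℝ := v 0 + r * v 1 + r ^ 2 / 2 * v 2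

/-- The derivative of `curve v`. -/
def curveDeriv (v : E3) (r : ℝ) : ℝ := v 1 + r * v 2

lemma curve_sub (v w : E3) (r : ℝ) : curve (v - w) r = curve v r - curve w r := by
  simp only [curve, PiLp.sub_apply]; ring

lemma curve_add (v : E3) (r u : ℝ) :
    curve v (r + u) = curve v r + u * curveDeriv v r + u ^ 2 / 2 * v 2 := by
  simp only [curve, curveDeriv]; ring

lemma curve_no_four_signs (v : E3) {r₁ r₂ r₃ r₄ : ℝ} (h₁₂ : r₁ < r₂) (h₂₃ : r₂ < r₃) (h₃₄ : r₃ < r₄)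
    (h₁ : curve v r₁ < 0) (h₂ : 0 < curve v r₂) (h₃ : curve v r₃ < 0) (h₄ : 0 < curve v r₄) :
    False := by
  have key : ∀ a b : ℝ, curve v b - curve v a = (b - a) * (v 1 + (a + b) / 2 * v 2) := fun a b => by
    simp only [curve]; ring
  have p1 : 0 < v 1 + (r₁ + r₂) / 2 * v 2 :=
    pos_of_mul_pos_right (by rw [← key]; linarith) (sub_pos.2 h₁₂).le
  have p2 : 0 < -(v 1 + (r₂ + r₃) / 2 * v 2) :=
    pos_of_mul_pos_right (by rw [mul_neg, ← key]; linarith) (sub_pos.2 h₂₃).le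
  have p3 : 0 < v 1 + (r₃ + r₄) / 2 * v 2 :=
    pos_of_mul_pos_right (by rw [← key]; linarith) (sub_pos.2 h₃₄).le
  rcases le_total 0 (v 2) with h | h <;> nlinarith

/-- The curves of `w` and `b` are nearly tangent at `r`, at the scale `h`. -/
def NearTangent (η s h : ℝ) (w b : E3) (r : ℝ) : Prop :=
  |curve (w - b) r| ≤ η * s * h ^ 2 ∧ |curveDeriv (w - b) r| ≤ η * s * h

lemma NearTangent.lt_curve {η s h κ e : ℝ} (hs : 0 < s) (hh : 0 < h) (hη : 0 ≤ η) (hηκ : 6 * η < κ)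
    (he : |e| = 1) {w b : E3} (hwb : κ * s ≤ e * (w 2 - b 2)) {r r' : ℝ}
    (ht : NearTangent η s h w b r) (hr : h ≤ |r' - r|) :
    η * s * h ^ 2 < e * curve w r' - e * curve b r' := by
  obtain ⟨h1, h2⟩ := ht
  set u := r' - r with hu
  have e1 : e * curve w r' - e * curve b r' =
      e * curve (w - b) r + e * (u * curveDeriv (w - b) r) + u ^ 2 / 2 * (e * (w 2 - b 2)) := by
    rw [← mul_sub, ← curve_sub, show r' = r + u by rw [hu]; ring, curve_add]
    simp only [PiLp.sub_apply]; ring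
  have e2 : -(η * s * h ^ 2) ≤ e * curve (w - b) r := by
    refine neg_le_of_abs_le ?_
    rw [abs_mul, he, one_mul]; exact h1
  have e3 : -(|u| * (η * s * h)) ≤ e * (u * curveDeriv (w - b) r) := by
    refine neg_le_of_abs_le ?_
    rw [abs_mul, he, one_mul, abs_mul]; gcongr
  have e4 : u ^ 2 / 2 * (κ * s) ≤ u ^ 2 / 2 * (e * (w 2 - b 2)) := by gcongr
  rw [e1, ← sq_abs u]
  rw [← sq_abs] at e4
  generalize |u| = x at *
  have hx : 0 < x := hh.trans_le hr
  have f1 : h ^ 2 ≤ x ^ 2 := by gcongr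
  have f2 : x * h ≤ x ^ 2 := by nlinarith
  have f3 : 0 < s * x ^ 2 := by positivity
  have hηs : 0 ≤ η * s := by positivity
  nlinarith [mul_pos (sub_pos.2 hηκ) f3, mul_le_mul_of_nonneg_left f1 hηs, mul_le_mul_of_nonneg_left f2 hηs]

section Rich

open Finset Classical

/-- The pairs of a point of `W` and a time of the grid where at least `n` points of `B` are nearly
tangent to it. -/
def richPairs (W B : Finset E3) (η s h c₀ : ℝ) (J n : ℕ) : Finset (E3 × ℕ) :=
  {x ∈ W ×ˢ range J | n ≤ #{b ∈ B | NearTangent η s h x.1 b (c₀ + x.2 * h)}}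

/-- The number of grid times at which the curves of `w` and `w'` are close. -/
def closeTimes (η s h c₀ : ℝ) (J : ℕ) (w w' : E3) : ℕ :=
  #{j ∈ range J | |curve (w - w') (c₀ + (j : ℕ) * h)| ≤ 2 * η * s * h ^ 2}

lemma mul_card_richPairs_sq_le {W B : Finset E3} {η s h κ e : ℝ} (c₀ : ℝ) {J ℓ n : ℕ} (hs : 0 < s)
    (hh : 0 < h) (hη : 0 ≤ η) (hηκ : 6 * η < κ) (he : |e| = 1)
    (hWB : ∀ w ∈ W, ∀ b ∈ B, κ * s ≤ e * (w 2 - b 2)) (hJ : J ≤ 2 ^ ℓ) (hn : 1 ≤ n) (hℓ : 1 ≤ ℓ) :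
    (n : ℝ) * (#(richPairs W B η s h c₀ J n) : ℝ) ^ 2 ≤
      655 * ℓ ^ 4 * #B * ∑ w ∈ W, ∑ w' ∈ W, (1 + (closeTimes η s h c₀ J w w' : ℝ) ^ 2) := by
  set R := richPairs W B η s h c₀ J n with hR
  have hS : ∀ x : E3 × ℕ, ∃ S : Finset E3, x ∈ R →
      S ⊆ {b ∈ B | NearTangent η s h x.1 b (c₀ + x.2 * h)} ∧ #S = n := by
    intro x
    by_cases hx : x ∈ R
    · rw [hR, richPairs, mem_filter] at hx
      obtain ⟨S, h1, h2⟩ := exists_subset_card_eq hx.2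
      exact ⟨S, fun _ => ⟨h1, h2⟩⟩
    · exact ⟨∅, fun h => absurd h hx⟩
  choose S hS using hS
  have hSB : ∀ x ∈ R, ∀ b ∈ S x, b ∈ B ∧ NearTangent η s h x.1 b (c₀ + x.2 * h) :=
    fun x hx b hb => mem_filter.1 ((hS x hx).1 hb)
  have hRW : ∀ x ∈ R, x.1 ∈ W ∧ x.2 < J := fun x hx => by
    rw [hR, richPairs, mem_filter, mem_product, mem_range] at hx; exact hx.1
  set E : E3 → E3 → Prop := fun w b => ∃ j, (w, j) ∈ R ∧ b ∈ S (w, j) with hE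
  set p : E3 → E3 → ℕ := fun w b => if hx : E w b then hx.choose else 0 with hp
  have hp1 : ∀ {w b}, E w b → (w, p w b) ∈ R ∧ b ∈ S (w, p w b) := fun {w b} hwb => by
    simp only [hp, dif_pos hwb]; exact hwb.choose_spec
  have hsep : ∀ j j' : ℕ, j ≠ j' → h ≤ |(c₀ + j' * h) - (c₀ + j * h)| := by
    intro j j' hne
    rw [show c₀ + j' * h - (c₀ + j * h) = ((j' : ℝ) - j) * h by ring, abs_mul, abs_of_pos hh]
    refine le_mul_of_one_le_left hh.le ?_
    have : (1 : ℤ) ≤ |(j' : ℤ) - j| := Int.one_le_abs (sub_ne_zero.2 (by exact_mod_cast hne.symm))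
    exact_mod_cast this
  have hgt : ∀ w b j j', (w, j) ∈ R → b ∈ S (w, j) → j ≠ j' →
      η * s * h ^ 2 < e * curve w (c₀ + j' * h) - e * curve b (c₀ + j' * h) :=
    fun w b j j' h1 h2 h3 => (hSB _ h1 _ h2).2.lt_curve hs hh hη hηκ he
      (hWB w (hRW _ h1).1 b (hSB _ h1 _ h2).1) (hsep j j' h3)
  have hle : ∀ w b j, (w, j) ∈ R → b ∈ S (w, j) →
      e * curve w (c₀ + j * h) - e * curve b (c₀ + j * h) ≤ η * s * h ^ 2 := by
    intro w b j h1 h2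
    rw [← mul_sub, ← curve_sub]
    refine (le_abs_self _).trans ?_
    rw [abs_mul, he, one_mul]
    exact (hSB _ h1 _ h2).2.1
  have huniq : ∀ {w b j}, (w, j) ∈ R → b ∈ S (w, j) → p w b = j := by
    intro w b j h1 h2
    by_contra hne
    have h3 : E w b := ⟨j, h1, h2⟩
    exact absurd (hgt w b _ _ (hp1 h3).1 (hp1 h3).2 hne) (not_lt.2 (hle w b j h1 h2))
  have hcross : ∀ {w w' b}, E w b → E w' b → p w b ≠ p w' b →
      e * curve w (c₀ + p w b * h) < e * curve w' (c₀ + p w b * h) := by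
    intro w w' b h1 h2 h3
    have a1 := hle w b _ (hp1 h1).1 (hp1 h1).2
    have a2 := hgt w' b _ _ (hp1 h2).1 (hp1 h2).2 h3.symm
    linarith
  have hcross' : ∀ {w a b}, E w a → E w b → p w a ≠ p w b →
      e * curve b (c₀ + p w a * h) < e * curve a (c₀ + p w a * h) := by
    intro w a b h1 h2 h3
    have a1 := hle w a _ (hp1 h1).1 (hp1 h1).2
    have a2 := hgt w b _ _ (hp1 h2).1 (hp1 h2).2 h3.symm
    linarith
  have hfour : ∀ (v w : E3) (i j k l : ℕ), i < j → j < k → k < l →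
      e * curve v (c₀ + i * h) < e * curve w (c₀ + i * h) →
      e * curve w (c₀ + j * h) < e * curve v (c₀ + j * h) →
      e * curve v (c₀ + k * h) < e * curve w (c₀ + k * h) →
      e * curve w (c₀ + l * h) < e * curve v (c₀ + l * h) → False := by
    intro v w i j k l hij hjk hkl h1 h2 h3 h4
    have mono : ∀ {i j : ℕ}, i < j → c₀ + i * h < c₀ + j * h := fun {i j} hij => by gcongr
    rcases eq_or_eq_neg_of_abs_eq he with rfl | rfl
    · exact curve_no_four_signs (v - w) (mono hij) (mono hjk) (mono hkl)
        (by rw [curve_sub]; linarith) (by rw [curve_sub]; linarith) (by rw [curve_sub]; linarith)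
        (by rw [curve_sub]; linarith)
    · exact curve_no_four_signs (w - v) (mono hij) (mono hjk) (mono hkl)
        (by rw [curve_sub]; linarith) (by rw [curve_sub]; linarith) (by rw [curve_sub]; linarith)
        (by rw [curve_sub]; linarith)
  have hC : ∀ w ∈ W, ∀ w' ∈ W, ∀ a ∈ B, ∀ b ∈ B, E w a → E w' a → E w b → E w' b →
      p w a < p w' a → p w b < p w' b → p w' a < p w b → False := by
    intro w _ w' _ a _ b _ ea ea' eb eb' h1 h2 h3
    exact hfour w w' _ _ _ _ h1 h3 h2 (hcross ea ea' h1.ne) (hcross ea' ea h1.ne')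
      (hcross eb eb' h2.ne) (hcross eb' eb h2.ne')
  have hI : IsOrderedIncidence W B E p n := by
    refine ⟨fun w hw j => ?_, ?_, hC⟩
    · by_cases hx : (w, j) ∈ R
      · rw [← (hS _ hx).2]
        refine card_le_card fun b hb => ?_
        obtain ⟨-, h1, h2⟩ := mem_filter.1 hb
        rw [← h2]; exact (hp1 h1).2
      · rw [card_eq_zero.2]
        · exact Nat.zero_le _
        · refine filter_eq_empty_iff.2 fun b _ hb => hx ?_
          rw [← hb.2]; exact (hp1 hb.1).1
    · intro w hw w' hw' a ha b hb ea ea' eb eb' h1 h2 h3 h4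
      rcases lt_trichotomy (p w' a) (p w b) with h5 | h5 | h5
      · exact hC w hw w' hw' a ha b hb ea ea' eb eb' h1 h2 h5
      · have a1 := hcross ea' ea h1.ne'
        have a2 := hcross eb eb' h2.ne
        rw [h5] at a1
        linarith
      · exact hfour b a _ _ _ _ h3 h5 h4 (hcross' ea eb h3.ne) (hcross' eb ea h3.ne')
          (hcross' ea' eb' h4.ne) (hcross' eb' ea' h4.ne')
  have hpJ : ∀ w b, p w b < 2 ^ ℓ := by
    intro w b
    by_cases hx : E w b
    · exact (hRW _ (hp1 hx).1).2.trans_le hJ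
    · simp only [hp, dif_neg hx]; positivity
  have hdeg : ∀ w ∈ W, #{b ∈ B | E w b} = n * #{j ∈ range J | (w, j) ∈ R} := by
    intro w hw
    have : {b ∈ B | E w b} = ({j ∈ range J | (w, j) ∈ R}).biUnion fun j => S (w, j) := by
      ext b
      simp only [mem_filter, mem_biUnion, mem_range]
      constructor
      · rintro ⟨-, j, h1, h2⟩
        exact ⟨j, ⟨(hRW _ h1).2, h1⟩, h2⟩
      · rintro ⟨j, ⟨-, h1⟩, h2⟩
        exact ⟨(hSB _ h1 _ h2).1, j, h1, h2⟩
    rw [this, card_biUnion, Finset.sum_congr rfl fun j hj => (hS _ (mem_filter.1 hj).2).2]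
    · rw [sum_const, smul_eq_mul, mul_comm]
    · intro x hx y hy hxy
      rw [Function.onFun, Finset.disjoint_left]
      intro b h1 h2
      exact hxy ((huniq (mem_filter.1 hx).2 h1).symm.trans (huniq (mem_filter.1 hy).2 h2))
  have hsum : ∑ w ∈ W, (#{b ∈ B | E w b} : ℝ) = n * #R := by
    have h1 : ∑ w ∈ W, #{j ∈ range J | (w, j) ∈ R} = #R := by
      rw [show R = (W ×ˢ range J).filter (· ∈ R) by
        ext x
        simp only [mem_filter, mem_product, mem_range]
        exact ⟨fun hx => ⟨hRW x hx, hx⟩, fun hx => hx.2⟩, card_filter, sum_product]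
      refine Finset.sum_congr rfl fun w _ => ?_
      rw [card_filter]
      refine Finset.sum_congr rfl fun j hj => ?_
      simp only [mem_filter, mem_product, mem_range]
      exact if_congr ⟨fun hx => hx.2, fun hx => ⟨hRW _ hx, hx⟩⟩ rfl rfl
    rw [← h1]
    push_cast
    rw [Finset.mul_sum]
    exact Finset.sum_congr rfl fun w hw => by rw [hdeg w hw]; push_cast; rfl
  have hN : ∀ w ∈ W, ∀ w' ∈ W, (#{b ∈ B | E w b ∧ E w' b ∧ p w b = p w' b} : ℝ) ≤
      n * (closeTimes η s h c₀ J w w' : ℝ) := by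
    intro w _ w' _
    norm_cast
    rw [closeTimes]
    refine Finset.card_le_mul_card_image_of_maps_to (f := p w) (fun b hb => ?_) n (fun j hj => ?_)
    · obtain ⟨-, h1, h2, h3⟩ := mem_filter.1 hb
      rw [mem_filter, mem_range]
      refine ⟨(hRW _ (hp1 h1).1).2, ?_⟩
      have a1 := (hSB _ (hp1 h1).1 _ (hp1 h1).2).2.1
      have a2 := (hSB _ (hp1 h2).1 _ (hp1 h2).2).2.1
      simp only [← h3] at a2
      rw [curve_sub] at a1 a2 ⊢
      rw [abs_le] at a1 a2 ⊢
      constructor <;> linarith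
    · by_cases hx : (w, j) ∈ R
      · rw [← (hS _ hx).2]
        refine card_le_card fun b hb => ?_
        obtain ⟨h1, h2⟩ := mem_filter.1 hb
        rw [← h2]; exact (hp1 (mem_filter.1 h1).2.1).2
      · rw [card_eq_zero.2]
        · exact Nat.zero_le _
        · refine filter_eq_empty_iff.2 fun b hb hbj => hx ?_
          rw [← hbj]; exact (hp1 (mem_filter.1 hb).2.1).1
  have hfin := hI.sq_sum_card_le hpJ hn hℓ hN
  rw [hsum] at hfin
  have hn0 : (0 : ℝ) < n := by exact_mod_cast hn
  refine le_of_mul_le_mul_left ?_ hn0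
  calc _ = (n * #R : ℝ) ^ 2 := by ring
    _ ≤ _ := hfin
    _ = _ := by ring

end Rich

lemma norm_le_sum_abs (v : E3) : ‖v‖ ≤ |v 0| + |v 1| + |v 2| := by
  rw [EuclideanSpace.norm_eq]
  refine Real.sqrt_le_iff.2 ⟨by positivity, ?_⟩
  simp only [Fin.sum_univ_three, Real.norm_eq_abs]
  nlinarith [abs_nonneg (v 0), abs_nonneg (v 1), abs_nonneg (v 2),
    mul_nonneg (abs_nonneg (v 0)) (abs_nonneg (v 1)),
    mul_nonneg (abs_nonneg (v 0)) (abs_nonneg (v 2)),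
    mul_nonneg (abs_nonneg (v 1)) (abs_nonneg (v 2))]

lemma sq_mul_norm_le_of_three {v : E3} {ρ d r₁ r₂ r₃ : ℝ} (hd : 0 < d)
    (hr₁ : r₁ ∈ Set.Icc (0 : ℝ) 2) (hr₂ : r₂ ∈ Set.Icc (0 : ℝ) 2)
    (h₁₂ : d ≤ |r₂ - r₁|) (h₂₃ : d ≤ |r₃ - r₂|) (h₁₃ : d ≤ |r₃ - r₁|)
    (h₁ : |curve v r₁| ≤ ρ) (h₂ : |curve v r₂| ≤ ρ) (h₃ : |curve v r₃| ≤ ρ) :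
    d ^ 2 * ‖v‖ ≤ 100 * ρ := by
  have key : ∀ a b : ℝ, curve v b - curve v a = (b - a) * (v 1 + (a + b) / 2 * v 2) := fun a b => by
    simp only [curve]; ring
  have hslope : ∀ a b : ℝ, d ≤ |b - a| → |curve v a| ≤ ρ → |curve v b| ≤ ρ →
      d * |v 1 + (a + b) / 2 * v 2| ≤ 2 * ρ := by
    intro a b hab ha hb
    calc d * |v 1 + (a + b) / 2 * v 2| ≤ |b - a| * |v 1 + (a + b) / 2 * v 2| := by gcongr
      _ = |curve v b - curve v a| := by rw [← abs_mul, ← key]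
      _ ≤ |curve v b| + |curve v a| := abs_sub _ _
      _ ≤ _ := by linarith
  have s1 := hslope r₁ r₂ h₁₂ h₁ h₂
  have s2 := hslope r₂ r₃ h₂₃ h₂ h₃
  have hd2 : d ≤ 2 := by
    refine h₁₂.trans (abs_le.2 ⟨?_, ?_⟩) <;> linarith [hr₁.1, hr₁.2, hr₂.1, hr₂.2]
  have hρ : 0 ≤ ρ := (abs_nonneg _).trans h₁
  have hz : d ^ 2 * |v 2| ≤ 8 * ρ := by
    have e : (r₃ - r₁) * v 2 =
        2 * ((v 1 + (r₂ + r₃) / 2 * v 2) - (v 1 + (r₁ + r₂) / 2 * v 2)) := by ring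
    have : d * |v 2| ≤ 2 * (|v 1 + (r₂ + r₃) / 2 * v 2| + |v 1 + (r₁ + r₂) / 2 * v 2|) := by
      calc d * |v 2| ≤ |r₃ - r₁| * |v 2| := by gcongr
        _ = 2 * |(v 1 + (r₂ + r₃) / 2 * v 2) - (v 1 + (r₁ + r₂) / 2 * v 2)| := by
          rw [← abs_mul, e, abs_mul, abs_two]
        _ ≤ _ := by gcongr; exact abs_sub _ _
    nlinarith
  have hy : d ^ 2 * |v 1| ≤ 20 * ρ := by
    have : |v 1| ≤ |v 1 + (r₁ + r₂) / 2 * v 2| + 2 * |v 2| := by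
      calc |v 1| = |(v 1 + (r₁ + r₂) / 2 * v 2) - (r₁ + r₂) / 2 * v 2| := by congr 1; ring
        _ ≤ |v 1 + (r₁ + r₂) / 2 * v 2| + |(r₁ + r₂) / 2 * v 2| := abs_sub _ _
        _ ≤ _ := by
          rw [abs_mul ((r₁ + r₂) / 2)]
          gcongr
          exact abs_le.2 ⟨by linarith [hr₁.1, hr₂.1], by linarith [hr₁.2, hr₂.2]⟩
    nlinarith [mul_le_mul_of_nonneg_left s1 hd.le, mul_le_mul_of_nonneg_left this (sq_nonneg d)]
  have hx : d ^ 2 * |v 0| ≤ 60 * ρ := by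
    have : |v 0| ≤ ρ + 2 * |v 1| + 2 * |v 2| := by
      calc |v 0| = |(curve v r₁ - r₁ * v 1) - r₁ ^ 2 / 2 * v 2| := by
            congr 1; simp only [curve]; ring
        _ ≤ |curve v r₁| + |r₁ * v 1| + |r₁ ^ 2 / 2 * v 2| :=
            (abs_sub _ _).trans (by gcongr; exact abs_sub _ _)
        _ ≤ _ := by
          rw [abs_mul, abs_mul (r₁ ^ 2 / 2)]
          gcongr
          · exact abs_le.2 ⟨by linarith [hr₁.1], hr₁.2⟩
          · rw [abs_of_nonneg (by positivity)]
            nlinarith [hr₁.1, hr₁.2]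
    have hd4 : d ^ 2 ≤ 4 := by nlinarith
    nlinarith [mul_le_mul_of_nonneg_left this (sq_nonneg d), mul_le_mul_of_nonneg_right hd4 hρ]
  calc d ^ 2 * ‖v‖ ≤ d ^ 2 * (|v 0| + |v 1| + |v 2|) := by gcongr; exact norm_le_sum_abs v
    _ ≤ _ := by linarith

lemma volume_curve_le (v : E3) {ρ d : ℝ} (hd : 0 < d) (h : 100 * ρ < d ^ 2 * ‖v‖) :
    volume {r ∈ Set.Icc (0 : ℝ) 1 | |curve v r| ≤ ρ} ≤ ENNReal.ofReal (4 * d) := by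
  set S := {r ∈ Set.Icc (0 : ℝ) 1 | |curve v r| ≤ ρ}
  have hcov : ∃ a b, S ⊆ closedBall a d ∪ closedBall b d := by
    by_contra! hno
    obtain ⟨p, hp, -⟩ := Set.not_subset.1 (hno 0 0)
    obtain ⟨q, hq, hq'⟩ := Set.not_subset.1 (hno p p)
    obtain ⟨x, hx, hx'⟩ := Set.not_subset.1 (hno p q)
    simp only [Set.mem_union, mem_closedBall, not_or, not_le, Real.dist_eq, or_self] at hq' hx'
    have hI : ∀ {y}, y ∈ S → y ∈ Set.Icc (0 : ℝ) 2 := fun hy => ⟨hy.1.1, by linarith [hy.1.2]⟩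
    exact absurd (sq_mul_norm_le_of_three hd (hI hp) (hI hq) hq'.le hx'.2.le hx'.1.le
      hp.2 hq.2 hx.2) (not_le.2 h)
  obtain ⟨a, b, hab⟩ := hcov
  calc volume S ≤ volume (closedBall a d ∪ closedBall b d) := measure_mono hab
    _ ≤ volume (closedBall a d) + volume (closedBall b d) := measure_union_le _ _
    _ = _ := by
      rw [Real.volume_closedBall, Real.volume_closedBall, ← ENNReal.ofReal_add (by positivity)
        (by positivity)]
      congr 1; ring

lemma volume_curve_le_sqrt (v : E3) {ρ : ℝ} (hρ : 0 < ρ) :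
    volume {r ∈ Set.Icc (0 : ℝ) 1 | |curve v r| ≤ ρ} ≤
      ENNReal.ofReal (44 * √(ρ / max ρ ‖v‖)) := by
  rcases le_total ‖v‖ ρ with h | h
  · rw [max_eq_left h, div_self hρ.ne', Real.sqrt_one]
    calc _ ≤ volume (Set.Icc (0 : ℝ) 1) := measure_mono fun r hr => hr.1
      _ ≤ _ := by rw [Real.volume_Icc]; gcongr; norm_num
  · rw [max_eq_right h]
    have hv : 0 < ‖v‖ := hρ.trans_le h
    refine (volume_curve_le v (d := 11 * √(ρ / ‖v‖)) (by positivity) ?_).trans_eq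
      (by congr 1; ring)
    rw [mul_pow, Real.sq_sqrt (by positivity), mul_assoc, div_mul_cancel₀ _ hv.ne']
    linarith

section Counting

open Finset Classical

lemma closeTimes_sq_mul_le {η s h c₀ : ℝ} {J : ℕ} (hs : 0 ≤ s) (hh : 0 < h) (hη : 0 ≤ η)
    (hc₀ : 0 ≤ c₀) (hJ : c₀ + J * h ≤ 2) {w w' : E3} (hw : ‖w - w'‖ ≤ s) :
    (closeTimes η s h c₀ J w w' : ℝ) ^ 2 * ‖w - w'‖ ≤ (4 + 3200 * η) * s := by
  set S : Finset ℕ := {j ∈ range J | |curve (w - w') (c₀ + (j : ℕ) * h)| ≤ 2 * η * s * h ^ 2}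
    with hS
  rw [show closeTimes η s h c₀ J w w' = #S from rfl]
  rcases le_or_gt (#S) 2 with h2 | h2
  · have : (#S : ℝ) ^ 2 ≤ 4 := by
      have : (#S : ℝ) ≤ 2 := by exact_mod_cast h2
      nlinarith [(Nat.cast_nonneg #S : (0 : ℝ) ≤ #S)]
    calc _ ≤ 4 * s := by gcongr
      _ ≤ _ := by nlinarith [mul_nonneg hη hs]
  · set q := (#S - 1) / 2 with hq
    have hq1 : 1 ≤ q := by omega
    have hq2 : 2 * q < #S := by omega
    have hq4 : #S ≤ 4 * q := by omega
    set f := S.orderEmbOfFin rfl with hf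
    have hgap : ∀ i k : ℕ, ∀ hi : i + k < #S, f ⟨i, by omega⟩ + k ≤ f ⟨i + k, hi⟩ := by
      intro i k
      induction k with
      | zero => intro hi; simp
      | succ k ih =>
        intro hi
        have := ih (by omega)
        have hlt : f ⟨i + k, by omega⟩ < f ⟨i + (k + 1), hi⟩ :=
          f.strictMono (by rw [Fin.mk_lt_mk]; omega)
        omega
    have hmem : ∀ i, c₀ + f i * h ∈ Set.Icc (0 : ℝ) 2 ∧
        |curve (w - w') (c₀ + f i * h)| ≤ 2 * η * s * h ^ 2 := by
      intro i
      have : f i ∈ S := S.orderEmbOfFin_mem rfl i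
      obtain ⟨h1, h2⟩ := mem_filter.1 this
      refine ⟨⟨by positivity, ?_⟩, h2⟩
      have : (f i : ℝ) ≤ J := by exact_mod_cast (mem_range.1 h1).le
      nlinarith
    have hdist : ∀ i k : Fin #S, f i + q ≤ f k → (q : ℝ) * h ≤ |(c₀ + f k * h) - (c₀ + f i * h)| := by
      intro i k hik
      refine le_trans ?_ (le_abs_self _)
      have : (f i : ℝ) + q ≤ f k := by exact_mod_cast hik
      nlinarith
    have a1 := hgap 0 q (by omega)
    have a2 := hgap q q (by omega)
    simp only [zero_add] at a1
    have := sq_mul_norm_le_of_three (v := w - w') (d := q * h) (by positivity)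
      (hmem ⟨0, by omega⟩).1 (hmem ⟨q, by omega⟩).1
      (hdist _ _ a1) (hdist _ _ a2) (hdist _ _ (by omega))
      (hmem ⟨0, by omega⟩).2 (hmem ⟨q, by omega⟩).2 (hmem ⟨q + q, by omega⟩).2
    have hq' : (q : ℝ) ^ 2 * ‖w - w'‖ ≤ 200 * η * s := by
      have hh2 : 0 < h ^ 2 := by positivity
      refine le_of_mul_le_mul_right ?_ hh2
      calc _ = (q * h) ^ 2 * ‖w - w'‖ := by ring
        _ ≤ _ := this
        _ = _ := by ring
    have hc : (#S : ℝ) ^ 2 ≤ 16 * q ^ 2 := by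
      have : (#S : ℝ) ≤ 4 * q := by exact_mod_cast hq4
      calc (#S : ℝ) ^ 2 ≤ (4 * q) ^ 2 := by gcongr
        _ = _ := by ring
    calc _ ≤ 16 * (q : ℝ) ^ 2 * ‖w - w'‖ := by gcongr
      _ ≤ _ := by nlinarith

lemma closeTimes_le (η s h c₀ : ℝ) (J : ℕ) (w w' : E3) : closeTimes η s h c₀ J w w' ≤ J := by
  simpa [closeTimes] using card_filter_le (range J) _

lemma le_one_add_sum_two_pow {M : ℕ} {g : ℝ} (hg : g ≤ 2 ^ M) :
    g ≤ 1 + ∑ i ∈ range M, 2 ^ i * (if 2 ^ i < g then (1 : ℝ) else 0) := by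
  induction M with
  | zero => simpa using hg
  | succ M ih =>
    rw [Finset.sum_range_succ]
    rcases le_or_gt g (2 ^ M) with h | h
    · have := ih h
      have : (0 : ℝ) ≤ 2 ^ M * (if 2 ^ M < g then (1 : ℝ) else 0) := by positivity
      linarith
    · have : ∑ i ∈ range M, (2 : ℝ) ^ i * (if 2 ^ i < g then (1 : ℝ) else 0) =
          ∑ i ∈ range M, (2 : ℝ) ^ i := by
        refine Finset.sum_congr rfl fun i hi => ?_
        rw [if_pos, mul_one]
        exact (pow_le_pow_right₀ one_le_two (mem_range.1 hi).le).trans_lt h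
      rw [this, if_pos h, geom_sum_eq (by norm_num)]
      rw [pow_succ] at hg
      linarith

/-- `F` has at most `A * R ^ α` points in every ball of radius `R ≥ δ₀`. -/
def BallBound (F : Finset E3) (A α δ₀ : ℝ) : Prop :=
  ∀ (w : E3) (R : ℝ), δ₀ ≤ R → (#{b ∈ F | dist b w ≤ R} : ℝ) ≤ A * R ^ α

lemma BallBound.sum_le {F S : Finset E3} {A α δ₀ R G : ℝ} {M : ℕ} (hF : BallBound F A α δ₀)
    (hα : 1 ≤ α) (hA : 0 ≤ A) (hR : 0 < R) (hδ₀ : 0 < δ₀) (hδR : δ₀ ≤ R) (hGR : δ₀ * G ≤ R)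
    (hGM : G ≤ 2 ^ M) (hSF : S ⊆ F) {w : E3} (hS : ∀ b ∈ S, dist b w ≤ R) {g : E3 → ℝ}
    (hg : ∀ b ∈ S, g b ≤ G) (hgd : ∀ b ∈ S, g b * dist b w ≤ R) :
    ∑ b ∈ S, g b ≤ (1 + M) * (A * R ^ α) := by
  have h1 : (#S : ℝ) ≤ A * R ^ α := by
    refine le_trans ?_ (hF w R hδR)
    exact_mod_cast card_le_card fun b hb => mem_filter.2 ⟨hSF hb, hS b hb⟩
  have h2 : ∀ i : ℕ, (2 : ℝ) ^ i * #{b ∈ S | 2 ^ i < g b} ≤ A * R ^ α := by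
    intro i
    have h2i : (1 : ℝ) ≤ 2 ^ i := one_le_pow₀ one_le_two
    rcases ({b ∈ S | 2 ^ i < g b} : Finset E3).eq_empty_or_nonempty with he | ⟨b₀, hb₀⟩
    · rw [he]; simp; positivity
    · obtain ⟨hb₀S, hb₀⟩ := mem_filter.1 hb₀
      have hGi : (2 : ℝ) ^ i ≤ G := hb₀.le.trans (hg b₀ hb₀S)
      have hle : δ₀ ≤ R / 2 ^ i := by
        rw [le_div_iff₀ (by positivity)]
        exact (mul_le_mul_of_nonneg_left hGi hδ₀.le).trans hGR
      have h3 : (#{b ∈ S | 2 ^ i < g b} : ℝ) ≤ A * (R / 2 ^ i) ^ α := by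
        refine le_trans ?_ (hF w _ hle)
        norm_cast
        refine card_le_card fun b hb => ?_
        obtain ⟨hbS, hb⟩ := mem_filter.1 hb
        refine mem_filter.2 ⟨hSF hbS, ?_⟩
        rw [le_div_iff₀ (by positivity), mul_comm]
        push_cast at hb ⊢
        exact (mul_le_mul_of_nonneg_right hb.le dist_nonneg).trans (hgd b hbS)
      have h4 : (R / 2 ^ i) ^ α ≤ R ^ α / 2 ^ i := by
        rw [Real.div_rpow hR.le (by positivity)]
        gcongr
        exact Real.self_le_rpow_of_one_le h2i hα
      calc _ ≤ (2 : ℝ) ^ i * (A * (R ^ α / 2 ^ i)) := by gcongr; exact h3.trans (by gcongr)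
        _ = _ := by field_simp
  calc ∑ b ∈ S, g b ≤ ∑ b ∈ S, (1 + ∑ i ∈ range M, 2 ^ i * (if 2 ^ i < g b then (1 : ℝ) else 0)) :=
        Finset.sum_le_sum fun b hb => le_one_add_sum_two_pow ((hg b hb).trans hGM)
    _ = #S + ∑ i ∈ range M, (2 : ℝ) ^ i * #{b ∈ S | 2 ^ i < g b} := by
        rw [Finset.sum_add_distrib, Finset.sum_comm]
        simp only [← Finset.mul_sum, Finset.sum_boole]
        simp
    _ ≤ A * R ^ α + ∑ i ∈ range M, A * R ^ α := add_le_add h1 (Finset.sum_le_sum fun i _ => h2 i)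
    _ = _ := by simp; ring

lemma volume_lt_card_le {ι : Type*} (G : Finset ι) (S : ι → Set ℝ) {m : ι → ℝ}
    (hm : ∀ b ∈ G, 0 ≤ m b) (hS : ∀ b ∈ G, volume (S b) ≤ ENNReal.ofReal (m b)) {Y : ℝ}
    (hY : 0 < Y) :
    volume {r | Y < #{b ∈ G | r ∈ S b}} ≤ ENNReal.ofReal ((∑ b ∈ G, m b) / Y) := by
  set T : ι → Set ℝ := fun b => toMeasurable volume (S b)
  have hT : ∀ b, MeasurableSet (T b) := fun b => measurableSet_toMeasurable _ _
  have h1 : {r | Y < #{b ∈ G | r ∈ S b}} ⊆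
      {r | ENNReal.ofReal Y ≤ ∑ b ∈ G, (T b).indicator (fun _ => (1 : ENNReal)) r} := by
    intro r hr
    simp only [Set.mem_ofPred_eq, Set.indicator_apply, Finset.sum_boole] at hr ⊢
    rw [← ENNReal.ofReal_natCast]
    refine ENNReal.ofReal_le_ofReal (hr.le.trans ?_)
    exact_mod_cast card_le_card fun b hb => by
      rw [mem_filter] at hb ⊢
      exact ⟨hb.1, subset_toMeasurable _ _ hb.2⟩
  have hmeas : Measurable fun r => ∑ b ∈ G, (T b).indicator (fun _ => (1 : ENNReal)) r :=
    Finset.measurable_sum _ fun b _ => measurable_const.indicator (hT b)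
  have h2 := mul_meas_ge_le_lintegral (μ := volume) hmeas (ENNReal.ofReal Y)
  rw [lintegral_finsetSum _ fun b _ => measurable_const.indicator (hT b)] at h2
  simp only [lintegral_indicator_const (hT _), one_mul, T, measure_toMeasurable] at h2
  rw [ENNReal.ofReal_div_of_pos hY, ENNReal.ofReal_sum_of_nonneg hm, ENNReal.le_div_iff_mul_le
    (Or.inl (by simpa using hY)) (Or.inl ENNReal.ofReal_ne_top), mul_comm]
  calc _ ≤ _ := by gcongr
    _ ≤ _ := h2
    _ ≤ _ := Finset.sum_le_sum hS

end Counting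

/-- The points `w` and `b` are at distance comparable to `s`, and their projections at `r` are close
at the scales `ρ` and `δ`. -/
def TangentAt (s ρ δ : ℝ) (w b : E3) (r : ℝ) : Prop :=
  s < ‖w - b‖ ∧ ‖w - b‖ ≤ 2 * s ∧ |curve (w - b) r| ≤ ρ ∧ |curveDeriv (w - b) r| ≤ δ

lemma abs_apply_le_norm (v : E3) (i : Fin 3) : |v i| ≤ ‖v‖ := by
  simpa using PiLp.norm_apply_le v i

lemma TangentAt.le_abs_two {s τ ρ δ r : ℝ} {w b : E3} (h : TangentAt s ρ δ w b r) (hs : 0 < s)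
    (hτ₀ : 0 < τ) (hτ : τ ≤ 1 / 800) (hρ : ρ ≤ s * τ ^ 2) (hδ : δ ≤ s * τ)
    (hr : r ∈ Set.Icc (0 : ℝ) 1) : s / 10 ≤ |(w - b) 2| := by
  obtain ⟨h1, -, h3, h4⟩ := h
  generalize w - b = v at *
  have hy : |v 1| ≤ δ + |v 2| := by
    calc |v 1| = |curveDeriv v r - r * v 2| := by simp only [curveDeriv]; congr 1; ring
      _ ≤ |curveDeriv v r| + |r * v 2| := abs_sub _ _
      _ ≤ δ + 1 * |v 2| := by
        rw [abs_mul]; gcongr; exact abs_le.2 ⟨by linarith [hr.1], hr.2⟩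
      _ = _ := by ring
  have hx : |v 0| ≤ ρ + |v 1| + |v 2| := by
    calc |v 0| = |(curve v r - r * v 1) - r ^ 2 / 2 * v 2| := by
          congr 1; simp only [curve]; ring
      _ ≤ |curve v r| + |r * v 1| + |r ^ 2 / 2 * v 2| :=
          (abs_sub _ _).trans (by gcongr; exact abs_sub _ _)
      _ ≤ ρ + 1 * |v 1| + 1 * |v 2| := by
        rw [abs_mul, abs_mul (r ^ 2 / 2)]
        gcongr
        · exact abs_le.2 ⟨by linarith [hr.1], hr.2⟩
        · rw [abs_of_nonneg (by positivity)]
          nlinarith [hr.1, hr.2]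
      _ = _ := by ring
  have := norm_le_sum_abs v
  have hτ2 : s * τ ^ 2 ≤ s * τ := by gcongr; nlinarith
  have : s * τ ≤ s * (1 / 800) := by gcongr
  linarith

lemma TangentAt.nearTangent {s τ ρ δ r r' : ℝ} {w b : E3} (h : TangentAt s ρ δ w b r) (hs : 0 < s)
    (hτ₀ : 0 < τ) (hρ : ρ ≤ s * τ ^ 2) (hδ : δ ≤ s * τ) (hr : |r' - r| ≤ τ) :
    NearTangent (3 / 400) s (400 * τ) w b r' := by
  obtain ⟨-, h2, h3, h4⟩ := h
  have h5 := (abs_apply_le_norm (w - b) 2).trans h2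
  rw [NearTangent]
  generalize w - b = v at *
  set u := r' - r with hu
  rw [show r' = r + u by rw [hu]; ring]
  constructor
  · rw [curve_add]
    calc _ ≤ |curve v r| + |u * curveDeriv v r| + |u ^ 2 / 2 * v 2| := abs_add_three _ _ _
      _ ≤ s * τ ^ 2 + τ * (s * τ) + τ ^ 2 / 2 * (2 * s) := by
        rw [abs_mul, abs_mul (u ^ 2 / 2), abs_of_nonneg (by positivity : 0 ≤ u ^ 2 / 2), ← sq_abs u]
        gcongr
        · exact h3.trans hρ
        · exact h4.trans hδ
      _ ≤ _ := by nlinarith [mul_pos hs (pow_pos hτ₀ 2)]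
  · have : curveDeriv v (r + u) = curveDeriv v r + u * v 2 := by simp only [curveDeriv]; ring
    rw [this]
    calc _ ≤ |curveDeriv v r| + |u * v 2| := abs_add_le _ _
      _ ≤ s * τ + τ * (2 * s) := by rw [abs_mul]; gcongr; exact h4.trans hδ
      _ = _ := by ring

lemma volume_curveDeriv_le {v : E3} {κ δ : ℝ} (hκ : 0 < κ) (hv : κ ≤ |v 2|) :
    volume {r | |curveDeriv v r| ≤ δ} ≤ ENNReal.ofReal (2 * δ / κ) := by
  have hv2 : v 2 ≠ 0 := by
    intro h; rw [h, abs_zero] at hv; linarith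
  calc volume {r | |curveDeriv v r| ≤ δ} ≤ volume (closedBall (-(v 1 / v 2)) (δ / κ)) := by
        refine measure_mono fun r hr => ?_
        rw [mem_closedBall, Real.dist_eq, le_div_iff₀ hκ]
        have e : curveDeriv v r = (r - -(v 1 / v 2)) * v 2 := by
          simp only [curveDeriv]; field_simp; ring
        calc _ ≤ |r - -(v 1 / v 2)| * |v 2| := by gcongr
          _ = |curveDeriv v r| := by rw [← abs_mul, e]
          _ ≤ δ := hr
    _ = _ := by rw [Real.volume_closedBall]; congr 1; ring

section Cells

open Finset Classical

/-- The points of `F` tangent to `w` at some time of the `m`-th cell of length `τ` in `[0, 1]`. -/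
def cellPartners (F : Finset E3) (s ρ δ τ : ℝ) (w : E3) (m : ℕ) : Finset E3 :=
  {b ∈ F | ∃ r ∈ Set.Icc (0 : ℝ) 1, r ∈ Set.Icc (m * τ) ((m + 1) * τ) ∧ TangentAt s ρ δ w b r}

/-- The cells of `[0, 1]` in which `w` has at least `2 * n` tangent partners. -/
def richCells (F : Finset E3) (s ρ δ τ : ℝ) (n : ℕ) (w : E3) : Finset ℕ :=
  {m ∈ range (⌊1 / τ⌋₊ + 1) | 2 * n ≤ #(cellPartners F s ρ δ τ w m)}

lemma volume_tangent_le {F : Finset E3} {s τ ρ δ Y : ℝ} {n : ℕ} {w : E3} (hs : 0 < s)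
    (hτ₀ : 0 < τ) (hτ : τ ≤ 1 / 800) (hρ : ρ ≤ s * τ ^ 2) (hδ₀ : 0 ≤ δ) (hδ : δ ≤ s * τ)
    (hY : 0 < Y) :
    volume {r ∈ Set.Icc (0 : ℝ) 1 | Y < #{b ∈ F | TangentAt s ρ δ w b r}} ≤
      ENNReal.ofReal (#(richCells F s ρ δ τ n w) * τ + 80 * n * δ / (s * τ * Y)) := by
  set I : ℕ → Set ℝ := fun m => Set.Icc (m * τ) ((m + 1) * τ) with hI
  set R := richCells F s ρ δ τ n w with hR
  set G := fun m => cellPartners F s ρ δ τ w m with hG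
  set Z : ℕ → Set ℝ := fun m =>
    {r | Y < #{b ∈ G m | r ∈ {r | |curveDeriv (w - b) r| ≤ δ}}} with hZ
  set U := range (⌊1 / τ⌋₊ + 1) with hU
  have hsub : {r ∈ Set.Icc (0 : ℝ) 1 | Y < #{b ∈ F | TangentAt s ρ δ w b r}} ⊆
      (⋃ m ∈ R, I m) ∪ ⋃ m ∈ U \ R, Z m := by
    rintro r ⟨hr, hrY⟩
    set m := ⌊r / τ⌋₊ with hm
    have hrm : r ∈ I m := by
      have h1 := Nat.floor_le (div_nonneg hr.1 hτ₀.le)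
      have h2 := Nat.lt_floor_add_one (r / τ)
      rw [le_div_iff₀ hτ₀] at h1
      rw [div_lt_iff₀ hτ₀] at h2
      exact ⟨h1, h2.le⟩
    have hmU : m ∈ U := by
      rw [hU, mem_range, Nat.lt_succ_iff]
      exact Nat.floor_le_floor (by gcongr; exact hr.2)
    by_cases hmR : m ∈ R
    · exact Or.inl (Set.mem_biUnion hmR hrm)
    · refine Or.inr (Set.mem_biUnion (mem_sdiff.2 ⟨hmU, hmR⟩) ?_)
      refine hrY.trans_le ?_
      norm_cast
      refine card_le_card fun b hb => ?_
      obtain ⟨hbF, hb⟩ := mem_filter.1 hb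
      exact mem_filter.2 ⟨mem_filter.2 ⟨hbF, r, hr, hrm, hb⟩, hb.2.2.2⟩
  have hIvol : ∀ m, volume (I m) = ENNReal.ofReal τ := fun m => by
    rw [hI, Real.volume_Icc]; congr 1; ring
  have hZvol : ∀ m ∈ U \ R, volume (Z m) ≤ ENNReal.ofReal (40 * n * δ / (s * Y)) := by
    intro m hm
    refine (volume_lt_card_le (G m) _ (m := fun _ => 2 * δ / (s / 10))
      (fun b _ => by positivity) (fun b hb => ?_) hY).trans ?_
    · obtain ⟨-, r, hr, -, hb⟩ := mem_filter.1 hb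
      exact volume_curveDeriv_le (by positivity) (hb.le_abs_two hs hτ₀ hτ hρ hδ hr)
    · have h1 : (#(G m) : ℝ) ≤ 2 * n := by
        by_contra! h
        obtain ⟨hmU, hmR⟩ := mem_sdiff.1 hm
        exact hmR (mem_filter.2 ⟨hmU, by exact_mod_cast h.le⟩)
      refine ENNReal.ofReal_le_ofReal ?_
      rw [sum_const, nsmul_eq_mul]
      calc _ ≤ 2 * n * (2 * δ / (s / 10)) / Y := by gcongr
        _ = _ := by field_simp; ring
  have hUcard : (#(U \ R) : ℝ) ≤ 2 / τ := by
    have h1 : #(U \ R) ≤ ⌊1 / τ⌋₊ + 1 := (card_le_card sdiff_subset).trans (by simp [hU])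
    have h2 : (1 : ℝ) ≤ 1 / τ := by rw [le_div_iff₀ hτ₀]; linarith
    calc (#(U \ R) : ℝ) ≤ ⌊1 / τ⌋₊ + 1 := by exact_mod_cast h1
      _ ≤ 1 / τ + 1 / τ := by gcongr; exact Nat.floor_le (by positivity)
      _ = _ := by ring
  calc _ ≤ volume (⋃ m ∈ R, I m) + volume (⋃ m ∈ U \ R, Z m) :=
        (measure_mono hsub).trans (measure_union_le _ _)
    _ ≤ ∑ m ∈ R, volume (I m) + ∑ m ∈ U \ R, volume (Z m) := by
        gcongr <;> exact measure_biUnion_finset_le _ _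
    _ ≤ ∑ m ∈ R, ENNReal.ofReal τ + ∑ m ∈ U \ R, ENNReal.ofReal (40 * n * δ / (s * Y)) := by
        refine add_le_add (Finset.sum_le_sum fun m _ => (hIvol m).le) (Finset.sum_le_sum hZvol)
    _ = ENNReal.ofReal (#R * τ + #(U \ R) * (40 * n * δ / (s * Y))) := by
        rw [ENNReal.ofReal_add (by positivity) (by positivity), sum_const, sum_const,
          ENNReal.ofReal_mul (by positivity), ENNReal.ofReal_mul (by positivity)]
        simp
    _ ≤ _ := by
        refine ENNReal.ofReal_le_ofReal ?_
        gcongr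
        calc _ ≤ 2 / τ * (40 * n * δ / (s * Y)) := by gcongr
          _ = _ := by field_simp; ring

end Cells

/-- The index of the cube of side `d` containing `w`. -/
def cubeIndex (d : ℝ) (w : E3) : Fin 3 → ℤ := fun i => ⌊w i / d⌋

lemma abs_sub_lt_of_cubeIndex_eq {d : ℝ} (hd : 0 < d) {w w' : E3}
    (h : cubeIndex d w = cubeIndex d w') (i : Fin 3) : |w i - w' i| < d := by
  have := Int.abs_sub_lt_one_of_floor_eq_floor (congrFun h i)
  rwa [← sub_div, abs_div, abs_of_pos hd, div_lt_one hd] at this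

lemma norm_sub_le_of_cubeIndex_eq {d : ℝ} (hd : 0 < d) {w w' : E3}
    (h : cubeIndex d w = cubeIndex d w') : ‖w - w'‖ ≤ 3 * d := by
  have h1 := fun i => (abs_sub_lt_of_cubeIndex_eq hd h i).le
  have := norm_le_sum_abs (w - w')
  simp only [PiLp.sub_apply] at this
  linarith [h1 0, h1 1, h1 2]

section Cubes

open Finset Classical

lemma card_cubeIndex_near_le {d : ℝ} (hd : 0 < d) (F : Finset E3) (b : E3) :
    #{q ∈ F.image (cubeIndex d) | ∃ w, cubeIndex d w = q ∧ ‖w - b‖ ≤ 60 * d} ≤ 123 ^ 3 := by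
  calc _ ≤ #(Finset.Icc (fun i => cubeIndex d b i - 61) (fun i => cubeIndex d b i + 61)) := by
        refine card_le_card fun q hq => ?_
        obtain ⟨-, w, rfl, hw⟩ := mem_filter.1 hq
        have h1 : ∀ i, |w i / d - b i / d| ≤ 60 := fun i => by
          rw [← sub_div, abs_div, abs_of_pos hd, div_le_iff₀ hd]
          exact (abs_apply_le_norm (w - b) i).trans hw
        refine Finset.mem_Icc.2 ⟨fun i => ?_, fun i => ?_⟩
        · have := (abs_le.1 (h1 i)).1
          have h2 : (⌊b i / d⌋ : ℝ) - 60 ≤ w i / d := by linarith [Int.floor_le (b i / d)]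
          have : ⌊b i / d⌋ - 60 ≤ ⌊w i / d⌋ := Int.le_floor.2 (by exact_mod_cast h2)
          simp only [cubeIndex]; omega
        · have := (abs_le.1 (h1 i)).2
          have h2 : (⌊w i / d⌋ : ℝ) - 60 ≤ b i / d := by linarith [Int.floor_le (w i / d)]
          have : ⌊w i / d⌋ - 60 ≤ ⌊b i / d⌋ := Int.le_floor.2 (by exact_mod_cast h2)
          simp only [cubeIndex]; omega
    _ = _ := by
        rw [Pi.card_Icc]
        simp only [Int.card_Icc, Fin.prod_univ_three]
        have : ∀ x : ℤ, (x + 61 + 1 - (x - 61)).toNat = 123 := fun x => by omega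
        simp only [this]
        norm_num

/-- The points of `F` in the cube of side `s / 20` with index `q`. -/
def cubePart (F : Finset E3) (s : ℝ) (q : Fin 3 → ℤ) : Finset E3 :=
  {w ∈ F | cubeIndex (s / 20) w = q}

/-- The points of `F` near the cube with index `q` whose height is separated from that of the points
of the cube, on the side given by the sign `e`. -/
def cubeOpposite (F : Finset E3) (s : ℝ) (q : Fin 3 → ℤ) (e : ℝ) : Finset E3 :=
  {b ∈ F | ∀ w ∈ cubePart F s q, ‖w - b‖ ≤ 3 * s ∧ 1 / 20 * s ≤ e * (w 2 - b 2)}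

lemma sum_card_cubePart (F : Finset E3) (s : ℝ) :
    ∑ q ∈ F.image (cubeIndex (s / 20)), #(cubePart F s q) = #F :=
  (card_eq_sum_card_image _ F).symm

lemma sum_card_cubeOpposite_le (F : Finset E3) {s : ℝ} (hs : 0 < s) (e : ℝ) :
    ∑ q ∈ F.image (cubeIndex (s / 20)), #(cubeOpposite F s q e) ≤ 123 ^ 3 * #F := by
  simp only [cubeOpposite, card_filter]
  rw [Finset.sum_comm, mul_comm (123 ^ 3)]
  refine Finset.sum_le_card_nsmul F _ (123 ^ 3) fun b _ => ?_
  rw [← card_filter]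
  refine le_trans (card_le_card fun q hq => ?_) (card_cubeIndex_near_le (d := s / 20) (by positivity) F b)
  obtain ⟨h1, h2⟩ := mem_filter.1 hq
  obtain ⟨w, hw, hwq⟩ := mem_image.1 h1
  exact mem_filter.2 ⟨h1, w, hwq, by linarith [(h2 w (mem_filter.2 ⟨hw, hwq⟩)).1]⟩

lemma exists_mem_richPairs {F : Finset E3} {s τ ρ δ : ℝ} {n m J : ℕ} {w : E3} (hs : 0 < s)
    (hτ₀ : 0 < τ) (hτ : τ ≤ 1 / 800) (hρ : ρ ≤ s * τ ^ 2) (hδ : δ ≤ s * τ)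
    (hJ : ⌊1 / τ⌋₊ / 400 < J) (hw : w ∈ F) (hm : m ∈ richCells F s ρ δ τ n w) :
    ∃ e ∈ ({1, -1} : Finset ℝ), (w, m / 400) ∈ richPairs (cubePart F s (cubeIndex (s / 20) w))
      (cubeOpposite F s (cubeIndex (s / 20) w) e) (3 / 400) s (400 * τ) ((m % 400 : ℕ) * τ) J n := by
  set q := cubeIndex (s / 20) w with hq
  obtain ⟨hm1, hm2⟩ := mem_filter.1 hm
  have hmJ : m / 400 < J := by
    rw [mem_range] at hm1
    have : m ≤ ⌊1 / τ⌋₊ := by omega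
    exact (Nat.div_le_div_right this).trans_lt hJ
  have hwq : w ∈ cubePart F s q := mem_filter.2 ⟨hw, rfl⟩
  have htime : ((m % 400 : ℕ) : ℝ) * τ + ((m / 400 : ℕ) : ℝ) * (400 * τ) = m * τ := by
    have : ((m % 400 : ℕ) : ℝ) + 400 * ((m / 400 : ℕ) : ℝ) = m := by
      exact_mod_cast Nat.mod_add_div m 400
    rw [← this]; ring
  set T : ℝ → Finset E3 := fun e => {b ∈ cubeOpposite F s q e |
    NearTangent (3 / 400) s (400 * τ) w b (m * τ)} with hT
  have hsub : cellPartners F s ρ δ τ w m ⊆ T 1 ∪ T (-1) := by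
    intro b hb
    obtain ⟨hbF, r, hr, hrm, ht⟩ := mem_filter.1 hb
    have hnear : NearTangent (3 / 400) s (400 * τ) w b (m * τ) :=
      ht.nearTangent hs hτ₀ hρ hδ (abs_le.2 ⟨by linarith [hrm.2], by linarith [hrm.1]⟩)
    have hz := ht.le_abs_two hs hτ₀ hτ hρ hδ hr
    rw [PiLp.sub_apply] at hz
    have hcube : ∀ w' ∈ cubePart F s q, ‖w' - b‖ ≤ 3 * s ∧ |w' 2 - w 2| ≤ s / 20 := by
      intro w' hw'
      have he := (mem_filter.1 hw').2
      refine ⟨?_, (abs_sub_lt_of_cubeIndex_eq (by positivity) he 2).le⟩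
      have := norm_sub_le_of_cubeIndex_eq (by positivity) he
      calc _ ≤ ‖w' - w‖ + ‖w - b‖ := norm_sub_le_norm_sub_add_norm_sub _ _ _
        _ ≤ 3 * (s / 20) + 2 * s := add_le_add this ht.2.1
        _ ≤ _ := by linarith
    rw [mem_union]
    rcases le_abs'.1 hz with hz | hz
    · refine Or.inr (mem_filter.2 ⟨mem_filter.2 ⟨hbF, fun w' hw' => ⟨(hcube w' hw').1, ?_⟩⟩, hnear⟩)
      have := (abs_le.1 (hcube w' hw').2).2
      linarith
    · refine Or.inl (mem_filter.2 ⟨mem_filter.2 ⟨hbF, fun w' hw' => ⟨(hcube w' hw').1, ?_⟩⟩, hnear⟩)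
      have := (abs_le.1 (hcube w' hw').2).1
      linarith
  have hcard : 2 * n ≤ #(T 1) + #(T (-1)) :=
    hm2.trans ((card_le_card hsub).trans (card_union_le _ _))
  have hmem : ∀ e, n ≤ #(T e) → (w, m / 400) ∈ richPairs (cubePart F s q)
      (cubeOpposite F s q e) (3 / 400) s (400 * τ) ((m % 400 : ℕ) * τ) J n := fun e he =>
    mem_filter.2 ⟨mem_product.2 ⟨hwq, mem_range.2 hmJ⟩, by simpa only [htime] using he⟩
  rcases le_or_gt n #(T 1) with h | h
  · exact ⟨1, by simp, hmem _ h⟩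
  · exact ⟨-1, by simp, hmem _ (by omega)⟩

lemma sum_card_richCells_le_sum {F : Finset E3} {s τ ρ δ : ℝ} {n J : ℕ} (hs : 0 < s)
    (hτ₀ : 0 < τ) (hτ : τ ≤ 1 / 800) (hρ : ρ ≤ s * τ ^ 2) (hδ : δ ≤ s * τ)
    (hJ : ⌊1 / τ⌋₊ / 400 < J) :
    ∑ w ∈ F, #(richCells F s ρ δ τ n w) ≤ ∑ k ∈ range 400, ∑ e ∈ ({1, -1} : Finset ℝ),
      ∑ q ∈ F.image (cubeIndex (s / 20)), #(richPairs (cubePart F s q) (cubeOpposite F s q e)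
        (3 / 400) s (400 * τ) (k * τ) J n) := by
  set P : ℕ → ℝ → (Fin 3 → ℤ) → Finset (E3 × ℕ) := fun k e q => richPairs (cubePart F s q)
    (cubeOpposite F s q e) (3 / 400) s (400 * τ) (k * τ) J n with hP
  have hsub : F.sigma (fun w => richCells F s ρ δ τ n w) ⊆
      (range 400).biUnion fun k => ({1, -1} : Finset ℝ).biUnion fun e =>
        (F.image (cubeIndex (s / 20))).biUnion fun q =>
          (P k e q).image fun x => ⟨x.1, k + 400 * x.2⟩ := by
    rintro ⟨w, m⟩ hwm
    obtain ⟨hw, hm⟩ := mem_sigma.1 hwm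
    obtain ⟨e, he, hP⟩ := exists_mem_richPairs hs hτ₀ hτ hρ hδ hJ hw hm
    simp only [mem_biUnion]
    refine ⟨m % 400, mem_range.2 (Nat.mod_lt _ (by norm_num)), e, he, _, mem_image_of_mem _ hw,
      mem_image.2 ⟨_, hP, ?_⟩⟩
    simp only [Nat.mod_add_div]
  rw [← card_sigma]
  refine (card_le_card hsub).trans (card_biUnion_le.trans (Finset.sum_le_sum fun k _ => ?_))
  refine card_biUnion_le.trans (Finset.sum_le_sum fun e _ => ?_)
  exact card_biUnion_le.trans (Finset.sum_le_sum fun q _ => card_image_le)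

lemma sum_sum_closeTimes_le {F : Finset E3} {s τ A α δ₀ c₀ : ℝ} {ℓ J : ℕ} (hF : BallBound F A α δ₀)
    (hα : 1 ≤ α) (hA : 0 ≤ A) (hδ₀ : 0 < δ₀) (hs : 0 < s) (hτ₀ : 0 < τ) (hτ : τ ≤ 1 / 800)
    (hδs : δ₀ ≤ s * τ ^ 2) (hℓ : 1 ≤ ℓ) (hτℓ : 1 / τ ≤ 2 ^ ℓ) (hc₀ : 0 ≤ c₀)
    (hcJ : c₀ + J * (400 * τ) ≤ 2) (q : Fin 3 → ℤ) :
    ∑ w ∈ cubePart F s q, ∑ w' ∈ cubePart F s q,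
      (1 + (closeTimes (3 / 400) s (400 * τ) c₀ J w w' : ℝ) ^ 2) ≤
      #(cubePart F s q) * (87 * ℓ * (A * s ^ α)) := by
  rw [← nsmul_eq_mul]
  refine Finset.sum_le_card_nsmul _ _ _ fun w hw => ?_
  have hℓ' : (1 : ℝ) ≤ ℓ := by exact_mod_cast hℓ
  have hdist : ∀ b ∈ cubePart F s q, ‖w - b‖ ≤ s := fun b hb => by
    have := norm_sub_le_of_cubeIndex_eq (by positivity)
      ((mem_filter.1 hw).2.trans (mem_filter.1 hb).2.symm)
    linarith
  have hJτ : (J : ℝ) * τ ≤ 1 / 200 := by linarith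
  have hG : (1 / τ ^ 2 : ℝ) ≤ 2 ^ (2 * ℓ) := by
    calc (1 / τ ^ 2 : ℝ) = (1 / τ) ^ 2 := by rw [div_pow, one_pow]
      _ ≤ (2 ^ ℓ) ^ 2 := by gcongr
      _ = _ := by rw [← pow_mul, mul_comm]
  have hτ2 : τ ^ 2 ≤ 1 := by nlinarith
  have := hF.sum_le (S := cubePart F s q) (R := s) (G := 1 / τ ^ 2) (M := 2 * ℓ) (w := w)
    (g := fun b => (1 + (closeTimes (3 / 400) s (400 * τ) c₀ J w b : ℝ) ^ 2) / 29) hα hA hs hδ₀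
    (hδs.trans (by nlinarith)) (by rw [mul_one_div, div_le_iff₀ (by positivity)]; exact hδs)
    hG (filter_subset _ _) (fun b hb => by rw [dist_comm, dist_eq_norm]; exact hdist b hb)
    (fun b hb => ?_) (fun b hb => ?_)
  · rw [← Finset.sum_div, div_le_iff₀ (by norm_num)] at this
    refine this.trans ?_
    push_cast
    have : 0 ≤ A * s ^ α := by positivity
    nlinarith
  · have h1 : (closeTimes (3 / 400) s (400 * τ) c₀ J w b : ℝ) ≤ J := by
      exact_mod_cast closeTimes_le _ _ _ _ _ _ _
    rw [div_le_div_iff₀ (by norm_num) (by positivity), one_mul]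
    have h2 : (closeTimes (3 / 400) s (400 * τ) c₀ J w b : ℝ) * τ ≤ 1 / 200 :=
      (mul_le_mul_of_nonneg_right h1 hτ₀.le).trans hJτ
    have h3 : ((closeTimes (3 / 400) s (400 * τ) c₀ J w b : ℝ) * τ) ^ 2 ≤ 1 := by
      refine pow_le_one₀ (by positivity) (h2.trans (by norm_num))
    nlinarith
  · have h1 := closeTimes_sq_mul_le (η := 3 / 400) (s := s) (h := 400 * τ) (c₀ := c₀) (J := J) hs.le
      (by positivity) (by norm_num) hc₀ hcJ (hdist b hb)
    rw [dist_comm, dist_eq_norm]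
    linarith [hdist b hb]

lemma sum_card_richCells_le {F : Finset E3} {s τ ρ δ A α δ₀ : ℝ} {ℓ n : ℕ} (hF : BallBound F A α δ₀)
    (hα : 1 ≤ α) (hA : 0 ≤ A) (hδ₀ : 0 < δ₀) (hs : 0 < s) (hτ₀ : 0 < τ) (hτ : τ ≤ 1 / 800)
    (hδs : δ₀ ≤ s * τ ^ 2) (hρ : ρ ≤ s * τ ^ 2) (hδ : δ ≤ s * τ) (hℓ : 1 ≤ ℓ)
    (hτℓ : 1 / τ ≤ 2 ^ ℓ) (hn : 1 ≤ n) :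
    (∑ w ∈ F, #(richCells F s ρ δ τ n w) : ℝ) ≤
      2 * 10 ^ 11 * #F * √(ℓ ^ 5 * (A * s ^ α) / n) := by
  set J := ⌊1 / τ⌋₊ / 400 + 1 with hJ
  set X := √(ℓ ^ 5 * (A * s ^ α) / n) with hX
  have hJle : (J : ℝ) ≤ 1 / (400 * τ) + 1 := by
    have h1 : ((⌊1 / τ⌋₊ / 400 : ℕ) : ℝ) ≤ (⌊1 / τ⌋₊ : ℝ) / 400 := Nat.cast_div_le
    have h2 : (⌊1 / τ⌋₊ : ℝ) ≤ 1 / τ := Nat.floor_le (by positivity)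
    have h3 : 1 / (400 * τ) = 1 / τ / 400 := by field_simp
    rw [hJ, h3]
    push_cast
    linarith
  have hJτ : (J : ℝ) * (400 * τ) ≤ 1 + 400 * τ := by
    calc _ ≤ (1 / (400 * τ) + 1) * (400 * τ) := by gcongr
      _ = _ := by field_simp
  have hJℓ : J ≤ 2 ^ ℓ := by
    have h1 : (J : ℝ) ≤ 1 / τ := by
      rw [le_div_iff₀ hτ₀]
      linarith
    exact_mod_cast h1.trans hτℓ
  have hrich : ∀ k : ℕ, k < 400 → ∀ e ∈ ({1, -1} : Finset ℝ), ∀ q,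
      (#(richPairs (cubePart F s q) (cubeOpposite F s q e) (3 / 400) s (400 * τ) (k * τ) J n) : ℝ) ≤
        120 * X * (#(cubeOpposite F s q e) + #(cubePart F s q)) := by
    intro k hk e he q
    have hk' : (k : ℝ) * τ ≤ 399 * τ := by
      gcongr
      exact_mod_cast (by omega : k ≤ 399)
    have he' : |e| = 1 := by
      rw [mem_insert, mem_singleton] at he
      rcases he with rfl | rfl <;> simp
    have h1 := mul_card_richPairs_sq_le (W := cubePart F s q) (B := cubeOpposite F s q e)
      (η := 3 / 400) (κ := 1 / 20) (k * τ) hs (by positivity : 0 < 400 * τ) (by norm_num)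
      (by norm_num) he' (fun w hw b hb => ((mem_filter.1 hb).2 w hw).2) hJℓ hn hℓ
    have h2 := sum_sum_closeTimes_le (c₀ := k * τ) (J := J) hF hα hA hδ₀ hs hτ₀ hτ hδs hℓ hτℓ
      (by positivity) (by linarith) q
    set B : ℝ := ((#(cubeOpposite F s q e) : ℕ) : ℝ)
    set W : ℝ := ((#(cubePart F s q) : ℕ) : ℝ)
    have hB : 0 ≤ B := Nat.cast_nonneg _
    have hW : 0 ≤ W := Nat.cast_nonneg _
    have hn' : (0 : ℝ) < n := by exact_mod_cast hn
    have hX2 : n * X ^ 2 = ℓ ^ 5 * (A * s ^ α) := by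
      rw [hX, Real.sq_sqrt (by positivity)]
      field_simp
    refine le_of_sq_le_sq ?_ (by positivity)
    refine le_of_mul_le_mul_left ?_ hn'
    calc _ ≤ _ := h1
      _ ≤ 655 * ℓ ^ 4 * B * (W * (87 * ℓ * (A * s ^ α))) := by gcongr
      _ = 56985 * (n * X ^ 2) * (B * W) := by rw [hX2]; ring
      _ ≤ 56985 * (n * X ^ 2) * ((B + W) ^ 2 / 4) := by
        gcongr
        nlinarith [sq_nonneg (B - W)]
      _ ≤ _ := by
        have : 0 ≤ n * X ^ 2 * (B + W) ^ 2 := by positivity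
        nlinarith
  have hBsum : ∀ e, (∑ q ∈ F.image (cubeIndex (s / 20)), (#(cubeOpposite F s q e) : ℝ)) ≤
      123 ^ 3 * #F := fun e => by exact_mod_cast sum_card_cubeOpposite_le F hs e
  have hWsum : (∑ q ∈ F.image (cubeIndex (s / 20)), (#(cubePart F s q) : ℝ)) = #F := by
    exact_mod_cast sum_card_cubePart F s
  calc (∑ w ∈ F, #(richCells F s ρ δ τ n w) : ℝ)
      ≤ ∑ k ∈ range 400, ∑ e ∈ ({1, -1} : Finset ℝ), ∑ q ∈ F.image (cubeIndex (s / 20)),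
        (#(richPairs (cubePart F s q) (cubeOpposite F s q e) (3 / 400) s (400 * τ) (k * τ) J n) :
          ℝ) := by
        exact_mod_cast sum_card_richCells_le_sum hs hτ₀ hτ hρ hδ (Nat.lt_succ_self _)
    _ ≤ ∑ k ∈ range 400, ∑ e ∈ ({1, -1} : Finset ℝ), 120 * X * (123 ^ 3 * #F + #F) := by
        refine Finset.sum_le_sum fun k hk => Finset.sum_le_sum fun e he => ?_
        refine (Finset.sum_le_sum fun q _ => hrich k (mem_range.1 hk) e he q).trans ?_
        rw [← Finset.mul_sum, Finset.sum_add_distrib, hWsum]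
        gcongr
        exact hBsum e
    _ ≤ _ := by
        have h3 : #({1, -1} : Finset ℝ) = 2 := card_pair (by norm_num)
        simp only [sum_const, h3, card_range, nsmul_eq_mul]
        have : 0 ≤ #F * X := by positivity
        norm_num
        nlinarith

end Cubes

section Scales

open Finset Classical

lemma volume_near_le {F : Finset E3} {A α δ₀ ρ s Y : ℝ} {M : ℕ} {w : E3} (hF : BallBound F A α δ₀)
    (hα : 1 ≤ α) (hA : 0 ≤ A) (hδ₀ : 0 < δ₀) (hδρ : δ₀ ≤ ρ) (hρs : ρ ≤ s) (hM : s / ρ ≤ 2 ^ M)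
    (hY : 0 < Y) :
    volume {r ∈ Set.Icc (0 : ℝ) 1 | Y < #{b ∈ F | ‖w - b‖ ≤ s ∧ |curve (w - b) r| ≤ ρ}} ≤
      ENNReal.ofReal (44 * √(ρ / s) * ((1 + M) * (A * s ^ α)) / Y) := by
  have hρ : 0 < ρ := hδ₀.trans_le hδρ
  have hs : 0 < s := hρ.trans_le hρs
  set S := {b ∈ F | ‖w - b‖ ≤ s} with hS
  have hSs : ∀ b ∈ S, ‖w - b‖ ≤ s := fun b hb => (mem_filter.1 hb).2
  have h1 := volume_lt_card_le S (fun b => {r ∈ Set.Icc (0 : ℝ) 1 | |curve (w - b) r| ≤ ρ})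
    (m := fun b => 44 * √(ρ / max ρ ‖w - b‖)) (fun b _ => by positivity)
    (fun b _ => volume_curve_le_sqrt (w - b) hρ) hY
  refine (measure_mono ?_).trans (h1.trans (ENNReal.ofReal_le_ofReal ?_))
  · rintro r ⟨hr, hrY⟩
    refine hrY.trans_le ?_
    norm_cast
    refine card_le_card fun b hb => ?_
    obtain ⟨h2, h3, h4⟩ := mem_filter.1 hb
    exact mem_filter.2 ⟨mem_filter.2 ⟨h2, h3⟩, hr, h4⟩
  · have hmax : ∀ b, 0 < max ρ ‖w - b‖ := fun b => lt_max_of_lt_left hρ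
    have h2 := hF.sum_le (S := S) (R := s) (G := s / ρ) (M := M) (w := w)
      (g := fun b => s / max ρ ‖w - b‖) hα hA hs hδ₀ (hδρ.trans hρs)
      (by rw [mul_div_assoc', div_le_iff₀ hρ]; nlinarith) hM (filter_subset _ _)
      (fun b hb => by rw [dist_comm, dist_eq_norm]; exact hSs b hb)
      (fun b _ => by gcongr; exact le_max_left _ _)
      (fun b _ => by
        rw [dist_comm, dist_eq_norm, div_mul_eq_mul_div, div_le_iff₀ (hmax b)]
        gcongr
        exact le_max_right _ _)
    gcongr
    calc ∑ b ∈ S, 44 * √(ρ / max ρ ‖w - b‖)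
        ≤ ∑ b ∈ S, 44 * √(ρ / s) * (s / max ρ ‖w - b‖) := by
          refine Finset.sum_le_sum fun b hb => ?_
          rw [mul_assoc]
          gcongr
          have h3 : 1 ≤ s / max ρ ‖w - b‖ := by
            rw [one_le_div (hmax b)]
            exact max_le hρs (hSs b hb)
          have h4 : ρ / max ρ ‖w - b‖ = ρ / s * (s / max ρ ‖w - b‖) := by field_simp
          rw [h4, Real.sqrt_mul (by positivity)]
          gcongr
          exact Real.sqrt_le_iff.2 ⟨by positivity, by nlinarith⟩
      _ ≤ _ := by
          rw [← Finset.mul_sum]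
          gcongr

lemma BallBound.one_le {F : Finset E3} {A α δ₀ R : ℝ} (hF : BallBound F A α δ₀) (hne : F.Nonempty)
    (hR : δ₀ ≤ R) (hR₀ : 0 ≤ R) : 1 ≤ A * R ^ α := by
  obtain ⟨w, hw⟩ := hne
  refine le_trans ?_ (hF w R hR)
  exact_mod_cast card_pos.2 ⟨w, mem_filter.2 ⟨hw, by rwa [dist_self]⟩⟩

set_option maxHeartbeats 400000 in
lemma exists_volume_tangent_le {F : Finset E3} {A α δ₀ ε t δ s : ℝ} {ℓ : ℕ}
    (hF : BallBound F A α δ₀) (hne : F.Nonempty) (hα : 1 ≤ α) (hα' : α ≤ 3 / 2) (hA : 0 < A)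
    (hδ₀ : 0 < δ₀) (ht : 0 ≤ t) (hδ : exp t * δ₀ ≤ δ) (hδ1 : δ ≤ 1) (hε : 0 < ε)
    (hs : 640000 * (δ * exp (t / 5)) ≤ s) (hs2 : s ≤ 2) (hℓ : 1 ≤ ℓ) (hδℓ : 2 / δ ≤ 2 ^ ℓ) :
    ∃ m : E3 → ℝ, (∀ w, 0 ≤ m w) ∧
      (∀ w, volume {r ∈ Set.Icc (0 : ℝ) 1 |
        A * δ ^ (α - ε / 2) * exp (-t / 10) < #{b ∈ F | TangentAt s (exp (-t) * δ) δ w b r}} ≤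
          ENNReal.ofReal (m w)) ∧
      ∑ w ∈ F, m w ≤ 3 * 10 ^ 11 * #F * (ℓ ^ 3 * δ ^ (ε / 8)) := by
  have hδ0 : 0 < δ := (by positivity : 0 < exp t * δ₀).trans_le hδ
  have het : 1 ≤ exp (t / 5) := Real.one_le_exp (by positivity)
  have hs0 : 0 < s := lt_of_lt_of_le (by positivity) hs
  have hδs : 640000 * δ ≤ s := by nlinarith
  set Y := A * δ ^ (α - ε / 2) * exp (-t / 10) with hY
  have hY0 : 0 < Y := by positivity
  set τ := exp (-t / 10) * √(δ / s) with hτ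
  have hτ0 : 0 < τ := by positivity
  have hexp : exp (-t / 10) ^ 2 = exp (-(t / 5)) := by
    rw [← Real.exp_nat_mul]; congr 1; push_cast; ring
  have hsτ2 : s * τ ^ 2 = exp (-(t / 5)) * δ := by
    rw [hτ, mul_pow, Real.sq_sqrt (by positivity), hexp]; field_simp
  have hee : exp (-(t / 5)) * exp (t / 5) = 1 := by rw [← Real.exp_add]; simp
  have het1 : exp (-(t / 5)) ≤ 1 := Real.exp_le_one_iff.2 (by linarith)
  have hτ800 : τ ≤ 1 / 800 := by
    refine le_of_sq_le_sq ?_ (by norm_num)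
    refine le_of_mul_le_mul_left ?_ hs0
    rw [hsτ2]
    nlinarith
  have hρ : exp (-t) * δ ≤ s * τ ^ 2 := by
    rw [hsτ2]; gcongr; linarith
  have hδ₀ρ : δ₀ ≤ exp (-t) * δ := by
    rw [Real.exp_neg, inv_mul_eq_div, le_div_iff₀ (by positivity)]
    linarith
  have hδsτ : δ ≤ s * τ := by
    refine le_of_sq_le_sq ?_ (by positivity)
    calc δ ^ 2 = exp (-(t / 5)) * δ * (δ * exp (t / 5)) := by linear_combination -δ ^ 2 * hee
      _ ≤ exp (-(t / 5)) * δ * s := by gcongr; nlinarith [(by positivity : 0 < δ * exp (t / 5))]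
      _ = _ := by rw [← hsτ2]; ring
  have hτℓ : 1 / τ ≤ 2 ^ ℓ := by
    refine le_trans ?_ hδℓ
    rw [div_le_div_iff₀ hτ0 hδ0]
    nlinarith
  set x := A * s ^ α * τ ^ 2 * δ ^ (-(ε / 4)) with hx
  have hx1 : 1 ≤ x := by
    have h1 := hF.one_le hne (hδ₀ρ.trans hρ) (by positivity)
    have h2 : (s * τ ^ 2) ^ α ≤ s ^ α * τ ^ 2 := by
      rw [Real.mul_rpow hs0.le (by positivity)]
      gcongr
      exact Real.rpow_le_self_of_le_one (by positivity) (by nlinarith) hα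
    have h3 : 1 ≤ δ ^ (-(ε / 4)) :=
      Real.one_le_rpow_of_pos_of_le_one_of_nonpos hδ0 hδ1 (by linarith)
    calc 1 ≤ A * (s * τ ^ 2) ^ α := h1
      _ ≤ A * (s ^ α * τ ^ 2) * 1 := by rw [mul_one]; gcongr
      _ ≤ A * (s ^ α * τ ^ 2) * δ ^ (-(ε / 4)) := by gcongr
      _ = x := by rw [hx]; ring
  set n := ⌈x⌉₊ with hn
  have hn1 : 1 ≤ n := Nat.one_le_ceil_iff.2 (by linarith)
  have hxn : x ≤ n := Nat.le_ceil x
  have hnx : (n : ℝ) ≤ 2 * x := by linarith [Nat.ceil_lt_add_one (by linarith : 0 ≤ x)]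
  have hn0 : (0 : ℝ) < n := by linarith
  have hℓ' : (1 : ℝ) ≤ ℓ := by exact_mod_cast hℓ
  have hδε : 0 < δ ^ (ε / 4) := by positivity
  have hsecond : 80 * n * δ / (s * τ * Y) ≤ 160 * δ ^ (ε / 4) := by
    have e1 : τ * (exp (-t / 10))⁻¹ = δ ^ (1 / 2 : ℝ) * s ^ (-(1 / 2) : ℝ) := by
      rw [hτ, Real.sqrt_eq_rpow, Real.div_rpow hδ0.le hs0.le, Real.rpow_neg hs0.le]
      field_simp
    have e2 : s ^ (α - 3 / 2) * δ ^ (3 / 2 - α) ≤ 1 := by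
      have : s ^ (α - 3 / 2) = (s ^ (3 / 2 - α))⁻¹ := by
        rw [← Real.rpow_neg hs0.le]; congr 1; ring
      rw [this, inv_mul_le_one₀ (by positivity)]
      exact Real.rpow_le_rpow hδ0.le (by linarith) (by linarith)
    calc 80 * n * δ / (s * τ * Y) ≤ 80 * (2 * x) * δ / (s * τ * Y) := by gcongr
      _ = 160 * (s ^ α * s⁻¹) * (τ * (exp (-t / 10))⁻¹) *
          (δ ^ (-(ε / 4)) * δ * (δ ^ (α - ε / 2))⁻¹) := by
        rw [hx, hY]; field_simp; ring
      _ = 160 * (s ^ α * s ^ (-1 : ℝ) * s ^ (-(1 / 2) : ℝ)) *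
          (δ ^ (1 / 2 : ℝ) * δ ^ (-(ε / 4)) * δ ^ (1 : ℝ) * δ ^ (-(α - ε / 2))) := by
        rw [e1, Real.rpow_neg_one, Real.rpow_one, Real.rpow_neg hδ0.le (α - ε / 2)]; ring
      _ = 160 * s ^ (α - 3 / 2) * (δ ^ (3 / 2 - α) * δ ^ (ε / 4)) := by
        simp only [← Real.rpow_add hs0, ← Real.rpow_add hδ0]
        congr 1
        · congr 2
          ring
        · congr 1
          ring
      _ = 160 * (s ^ (α - 3 / 2) * δ ^ (3 / 2 - α)) * δ ^ (ε / 4) := by ring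
      _ ≤ 160 * 1 * δ ^ (ε / 4) := by gcongr
      _ = _ := by ring
  have hfirst : √(ℓ ^ 5 * (A * s ^ α) / n) * τ ≤ ℓ ^ 3 * δ ^ (ε / 8) := by
    refine le_of_sq_le_sq ?_ (by positivity)
    rw [mul_pow _ τ, Real.sq_sqrt (by positivity), mul_pow _ (δ ^ (ε / 8)),
      ← Real.rpow_mul_natCast hδ0.le, div_mul_eq_mul_div, div_le_iff₀ hn0]
    have e1 : (δ ^ (ε / 8 * (2 : ℕ)) : ℝ) = δ ^ (ε / 4) := by congr 1; push_cast; ring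
    have e2 : δ ^ (ε / 4) * δ ^ (-(ε / 4)) = 1 := by
      rw [← Real.rpow_add hδ0, add_neg_cancel, Real.rpow_zero]
    have e3 : A * s ^ α * τ ^ 2 = δ ^ (ε / 4) * x := by
      rw [hx]; linear_combination -(A * s ^ α * τ ^ 2) * e2
    rw [e1]
    calc (ℓ : ℝ) ^ 5 * (A * s ^ α) * τ ^ 2 = ℓ ^ 5 * (δ ^ (ε / 4) * x) := by rw [← e3]; ring
      _ ≤ ℓ ^ 6 * (δ ^ (ε / 4) * n) := by
        gcongr
        norm_num
      _ = _ := by ring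
  refine ⟨fun w => #(richCells F s (exp (-t) * δ) δ τ n w) * τ + 80 * n * δ / (s * τ * Y),
    fun w => by positivity,
    fun w => volume_tangent_le hs0 hτ0 hτ800 hρ hδ0.le hδsτ hY0, ?_⟩
  rw [Finset.sum_add_distrib, ← Finset.sum_mul, sum_const, nsmul_eq_mul]
  have h8 : δ ^ (ε / 4) ≤ δ ^ (ε / 8) :=
    Real.rpow_le_rpow_of_exponent_ge hδ0 hδ1 (by linarith)
  calc _ ≤ 2 * 10 ^ 11 * #F * √(ℓ ^ 5 * (A * s ^ α) / n) * τ + #F * (160 * δ ^ (ε / 4)) := by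
        gcongr
        exact sum_card_richCells_le hF hα hA.le hδ₀ hs0 hτ0 hτ800 (hδ₀ρ.trans hρ) hρ hδsτ hℓ hτℓ hn1
    _ = 2 * 10 ^ 11 * #F * (√(ℓ ^ 5 * (A * s ^ α) / n) * τ) + #F * (160 * (1 * δ ^ (ε / 4))) := by
        ring
    _ ≤ 2 * 10 ^ 11 * #F * (ℓ ^ 3 * δ ^ (ε / 8)) + #F * (160 * (ℓ ^ 3 * δ ^ (ε / 8))) := by
        gcongr
        exact one_le_pow₀ hℓ'
    _ ≤ _ := by
        have : 0 ≤ #F * (ℓ ^ 3 * δ ^ (ε / 8)) := by positivity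
        nlinarith

end Scales

lemma exists_scale {s x : ℝ} {ℓ : ℕ} (h₁ : s < x) (h₂ : x ≤ s * 2 ^ ℓ) :
    ∃ k < ℓ, s * 2 ^ k < x ∧ x ≤ 2 * (s * 2 ^ k) := by
  induction ℓ with
  | zero => rw [pow_zero, mul_one] at h₂; exact absurd h₁ (not_lt.2 h₂)
  | succ ℓ ih =>
    rcases le_or_gt x (s * 2 ^ ℓ) with h | h
    · obtain ⟨k, hk, h⟩ := ih h
      exact ⟨k, by omega, h⟩
    · exact ⟨ℓ, by omega, h, by rw [pow_succ] at h₂; linarith⟩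

section Scales

open Finset Classical

lemma volume_near_scale_le {F : Finset E3} {A α δ₀ ε t δ : ℝ} (hF : BallBound F A α δ₀)
    (hα : 1 ≤ α) (hα' : α ≤ 3 / 2) (hA : 0 < A) (hδ₀ : 0 < δ₀) (ht : 0 ≤ t)
    (hδ : exp t * δ₀ ≤ δ) (hδ1 : δ ≤ 1) (hε : 0 < ε) (w : E3) :
    volume {r ∈ Set.Icc (0 : ℝ) 1 | A * δ ^ (α - ε / 2) * exp (-t / 10) <
      #{b ∈ F | ‖w - b‖ ≤ 640000 * (δ * exp (t / 5)) ∧ |curve (w - b) r| ≤ exp (-t) * δ}} ≤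
      ENNReal.ofReal (10 ^ 9 * δ ^ (ε / 8)) := by
  have hδ0 : 0 < δ := (by positivity : 0 < exp t * δ₀).trans_le hδ
  have het : 1 ≤ exp (t / 5) := Real.one_le_exp (by positivity)
  have hδ₀ρ : δ₀ ≤ exp (-t) * δ := by
    rw [Real.exp_neg, inv_mul_eq_div, le_div_iff₀ (by positivity)]
    linarith
  have het1 : exp (-t) ≤ 1 := Real.exp_le_one_iff.2 (by linarith)
  set M := 20 + 2 * ⌈6 * t / 5⌉₊ with hM
  have hMt : (1 + M : ℝ) ≤ 24 * exp (t / 5) := by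
    have h1 := (Nat.ceil_lt_add_one (by positivity : 0 ≤ 6 * t / 5)).le
    have h2 := Real.add_one_le_exp (t / 5)
    rw [hM]
    push_cast
    linarith
  have hratio : 640000 * (δ * exp (t / 5)) / (exp (-t) * δ) = 640000 * exp (6 * t / 5) := by
    rw [show 6 * t / 5 = t / 5 + t by ring, Real.exp_add, Real.exp_neg]
    field_simp
  have hG : 640000 * (δ * exp (t / 5)) / (exp (-t) * δ) ≤ 2 ^ M := by
    rw [hratio, hM, pow_add, pow_mul]
    gcongr
    · norm_num
    · calc exp (6 * t / 5) ≤ exp (⌈6 * t / 5⌉₊ : ℝ) := by gcongr; exact Nat.le_ceil _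
        _ = exp 1 ^ ⌈6 * t / 5⌉₊ := (Real.exp_one_pow _).symm
        _ ≤ _ := by gcongr; linarith [Real.exp_one_lt_d9]
  have hρs : exp (-t) * δ ≤ 640000 * (δ * exp (t / 5)) := by nlinarith
  refine (volume_near_le hF hα hA.le hδ₀ hδ₀ρ hρs hG (by positivity)).trans
    (ENNReal.ofReal_le_ofReal ?_)
  have hsqrt : √(exp (-t) * δ / (640000 * (δ * exp (t / 5)))) = exp (-(3 * t / 5)) / 800 := by
    have : exp (-t) * δ / (640000 * (δ * exp (t / 5))) = (exp (-(3 * t / 5)) / 800) ^ 2 := by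
      rw [div_pow, ← Real.exp_nat_mul,
        show ((2 : ℕ) : ℝ) * -(3 * t / 5) = -t - t / 5 by push_cast; ring, Real.exp_sub]
      field_simp
      norm_num
    rw [this, Real.sqrt_sq (by positivity)]
  have hpow : (640000 * (δ * exp (t / 5))) ^ α ≤ 512000000 * δ ^ α * exp (3 * t / 10) := by
    rw [Real.mul_rpow (by norm_num) (by positivity), Real.mul_rpow hδ0.le (by positivity),
      ← Real.exp_mul, ← mul_assoc]
    have h1 : (640000 : ℝ) ^ α ≤ 512000000 := by
      calc (640000 : ℝ) ^ α ≤ 640000 ^ (3 / 2 : ℝ) :=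
            Real.rpow_le_rpow_of_exponent_le (by norm_num) hα'
        _ = ((800 : ℝ) ^ (2 : ℝ)) ^ (3 / 2 : ℝ) := by norm_num
        _ = 512000000 := by rw [← Real.rpow_mul (by norm_num)]; norm_num
    gcongr
    nlinarith
  have hδα : δ ^ α = δ ^ (α - ε / 2) * δ ^ (ε / 2) := by
    rw [← Real.rpow_add hδ0]; congr 1; ring
  have hexp : exp (-(3 * t / 5)) * exp (t / 5) * exp (3 * t / 10) = exp (-t / 10) := by
    rw [← Real.exp_add, ← Real.exp_add]; congr 1; ring
  have h8 : δ ^ (ε / 2) ≤ δ ^ (ε / 8) :=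
    Real.rpow_le_rpow_of_exponent_ge hδ0 hδ1 (by linarith)
  rw [hsqrt, div_le_iff₀ (by positivity)]
  calc _ ≤ 44 * (exp (-(3 * t / 5)) / 800) *
        (24 * exp (t / 5) * (A * (512000000 * δ ^ α * exp (3 * t / 10)))) := by gcongr
    _ = 44 * 24 * 640000 * A * (δ ^ (α - ε / 2) * δ ^ (ε / 2)) * exp (-t / 10) := by
        rw [← hδα, ← hexp]; ring
    _ ≤ 44 * 24 * 640000 * A * (δ ^ (α - ε / 2) * δ ^ (ε / 8)) * exp (-t / 10) := by gcongr
    _ ≤ _ := by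
        have : 0 ≤ A * (δ ^ (α - ε / 2) * δ ^ (ε / 8)) * exp (-t / 10) := by positivity
        nlinarith

lemma exists_volume_close_le {F : Finset E3} {A α δ₀ ε t δ : ℝ} {ℓ : ℕ}
    (hF : BallBound F A α δ₀) (hne : F.Nonempty) (hF1 : ∀ w ∈ F, ‖w‖ ≤ 1) (hα : 1 ≤ α)
    (hα' : α ≤ 3 / 2) (hA : 0 < A) (hδ₀ : 0 < δ₀) (ht : 0 ≤ t) (hδ : exp t * δ₀ ≤ δ) (hδ1 : δ ≤ 1)
    (hε : 0 < ε) (hℓ : 1 ≤ ℓ) (hδℓ : 2 / δ ≤ 2 ^ ℓ) :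
    ∃ m : E3 → ℝ, (∀ w, 0 ≤ m w) ∧
      (∀ w ∈ F, volume {r ∈ Set.Icc (0 : ℝ) 1 |
        (1 + ℓ) * (A * δ ^ (α - ε / 2) * exp (-t / 10)) <
          #{b ∈ F | |curve (w - b) r| ≤ exp (-t) * δ ∧ |curveDeriv (w - b) r| ≤ δ}} ≤
          ENNReal.ofReal (m w)) ∧
      ∑ w ∈ F, m w ≤ 4 * 10 ^ 11 * #F * (ℓ ^ 4 * δ ^ (ε / 8)) := by
  have hδ0 : 0 < δ := (by positivity : 0 < exp t * δ₀).trans_le hδ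
  have het : 1 ≤ exp (t / 5) := Real.one_le_exp (by positivity)
  have hℓ' : (1 : ℝ) ≤ ℓ := by exact_mod_cast hℓ
  set Y := A * δ ^ (α - ε / 2) * exp (-t / 10) with hY
  set s := 640000 * (δ * exp (t / 5)) with hs
  have hs0 : 0 < s := by positivity
  have hsδ : δ ≤ s := by nlinarith
  have hsℓ : 2 ≤ s * 2 ^ ℓ := by
    rw [div_le_iff₀ hδ0] at hδℓ
    nlinarith [pow_pos (two_pos : (0 : ℝ) < 2) ℓ]
  set T : ℕ → E3 → Set ℝ := fun k w => {r ∈ Set.Icc (0 : ℝ) 1 |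
    Y < #{b ∈ F | TangentAt (s * 2 ^ k) (exp (-t) * δ) δ w b r}} with hT
  set K := {k ∈ range ℓ | s * 2 ^ k ≤ 2} with hK
  have hscale : ∀ k, ∃ m : E3 → ℝ, (∀ w, 0 ≤ m w) ∧
      (k ∈ K → ∀ w, volume (T k w) ≤ ENNReal.ofReal (m w)) ∧
      ∑ w ∈ F, m w ≤ 3 * 10 ^ 11 * #F * (ℓ ^ 3 * δ ^ (ε / 8)) := by
    intro k
    by_cases hk : k ∈ K
    · obtain ⟨m, h1, h2, h3⟩ := exists_volume_tangent_le (s := s * 2 ^ k) hF hne hα hα' hA hδ₀ ht hδ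
        hδ1 hε (le_mul_of_one_le_right hs0.le (one_le_pow₀ one_le_two)) (mem_filter.1 hk).2 hℓ hδℓ
      exact ⟨m, h1, fun _ => h2, h3⟩
    · exact ⟨0, by simp, fun h => absurd h hk, by simp; positivity⟩
  choose m hm0 hm hmsum using hscale
  refine ⟨fun w => 10 ^ 9 * δ ^ (ε / 8) + ∑ k ∈ K, m k w,
    fun w => add_nonneg (by positivity) (Finset.sum_nonneg fun k _ => hm0 k w), fun w hw => ?_, ?_⟩
  · set Z := {r ∈ Set.Icc (0 : ℝ) 1 |
      Y < #{b ∈ F | ‖w - b‖ ≤ s ∧ |curve (w - b) r| ≤ exp (-t) * δ}} with hZ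
    have hsub : {r ∈ Set.Icc (0 : ℝ) 1 | (1 + ℓ) * Y <
        #{b ∈ F | |curve (w - b) r| ≤ exp (-t) * δ ∧ |curveDeriv (w - b) r| ≤ δ}} ⊆
        Z ∪ ⋃ k ∈ K, T k w := by
      rintro r ⟨hr, hrY⟩
      by_contra hno
      simp only [Set.mem_union, Set.mem_iUnion, not_or, not_exists] at hno
      have h1 : (#{b ∈ F | ‖w - b‖ ≤ s ∧ |curve (w - b) r| ≤ exp (-t) * δ} : ℝ) ≤ Y :=
        not_lt.1 fun h => hno.1 ⟨hr, h⟩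
      have h2 : ∀ k ∈ K, (#{b ∈ F | TangentAt (s * 2 ^ k) (exp (-t) * δ) δ w b r} : ℝ) ≤ Y :=
        fun k hk => not_lt.1 fun h => hno.2 k hk ⟨hr, h⟩
      have h3 : #{b ∈ F | |curve (w - b) r| ≤ exp (-t) * δ ∧ |curveDeriv (w - b) r| ≤ δ} ≤
          #{b ∈ F | ‖w - b‖ ≤ s ∧ |curve (w - b) r| ≤ exp (-t) * δ} +
          ∑ k ∈ K, #{b ∈ F | TangentAt (s * 2 ^ k) (exp (-t) * δ) δ w b r} := by
        refine le_trans (card_le_card fun b hb => ?_)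
          ((card_union_le _ _).trans (add_le_add_right card_biUnion_le _))
        obtain ⟨hbF, hb1, hb2⟩ := mem_filter.1 hb
        rw [mem_union, mem_biUnion]
        rcases le_or_gt ‖w - b‖ s with h | h
        · exact Or.inl (mem_filter.2 ⟨hbF, h, hb1⟩)
        · have hwb : ‖w - b‖ ≤ 2 := by
            linarith [norm_sub_le w b, hF1 w hw, hF1 b hbF]
          obtain ⟨k, hk, h4, h5⟩ := exists_scale h (hwb.trans hsℓ)
          exact Or.inr ⟨k, mem_filter.2 ⟨mem_range.2 hk, h4.le.trans hwb⟩,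
            mem_filter.2 ⟨hbF, h4, h5, hb1, hb2⟩⟩
      have h4 : (#K : ℝ) ≤ ℓ := by
        exact_mod_cast (card_filter_le _ _).trans (card_range ℓ).le
      refine absurd hrY (not_lt.2 ?_)
      have hY0 : 0 ≤ Y := by positivity
      calc _ ≤ _ := Nat.cast_le.2 h3
        _ = _ := by push_cast; rfl
        _ ≤ Y + ∑ k ∈ K, Y := add_le_add h1 (Finset.sum_le_sum h2)
        _ = Y + #K * Y := by rw [sum_const, nsmul_eq_mul]
        _ ≤ Y + ℓ * Y := by gcongr
        _ = _ := by ring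
    calc _ ≤ volume Z + ∑ k ∈ K, volume (T k w) :=
          (measure_mono hsub).trans ((measure_union_le _ _).trans
            (add_le_add_right (measure_biUnion_finset_le _ _) _))
      _ ≤ ENNReal.ofReal (10 ^ 9 * δ ^ (ε / 8)) + ∑ k ∈ K, ENNReal.ofReal (m k w) :=
          add_le_add (volume_near_scale_le hF hα hα' hA hδ₀ ht hδ hδ1 hε w)
            (Finset.sum_le_sum fun k hk => hm k hk w)
      _ = _ := by
          rw [← ENNReal.ofReal_sum_of_nonneg fun k _ => hm0 k w,
            ← ENNReal.ofReal_add (by positivity) (Finset.sum_nonneg fun k _ => hm0 k w)]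
  · have hKℓ : (#K : ℝ) ≤ ℓ := by
      exact_mod_cast (card_filter_le _ _).trans (card_range ℓ).le
    rw [Finset.sum_add_distrib, Finset.sum_comm, sum_const, nsmul_eq_mul]
    calc _ ≤ #F * (10 ^ 9 * δ ^ (ε / 8)) +
          ∑ k ∈ K, 3 * 10 ^ 11 * #F * (ℓ ^ 3 * δ ^ (ε / 8)) :=
          add_le_add le_rfl (Finset.sum_le_sum fun k _ => hmsum k)
      _ = #F * (10 ^ 9 * (1 * δ ^ (ε / 8))) +
          #K * (3 * 10 ^ 11 * #F * (ℓ ^ 3 * δ ^ (ε / 8))) := by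
          rw [sum_const, nsmul_eq_mul]; ring
      _ ≤ #F * (10 ^ 9 * (ℓ ^ 4 * δ ^ (ε / 8))) +
          ℓ * (3 * 10 ^ 11 * #F * (ℓ ^ 3 * δ ^ (ε / 8))) := by
          gcongr
          exact one_le_pow₀ hℓ'
      _ ≤ _ := by
          have : 0 ≤ #F * (ℓ ^ 4 * δ ^ (ε / 8)) := by positivity
          nlinarith

end Scales

lemma exists_two_div_le_two_pow {a δ : ℝ} (ha : 0 < a) (hδ : 0 < δ) (hδ1 : δ ≤ 1) :
    ∃ ℓ : ℕ, 1 ≤ ℓ ∧ 2 / δ ≤ 2 ^ ℓ ∧ (ℓ : ℝ) ≤ (2 + 2 / a) * δ ^ (-a) := by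
  have h1 : 1 ≤ 1 / δ := by rwa [one_le_div hδ]
  set x := Real.logb 2 (1 / δ) with hx
  have hx0 : 0 ≤ x := Real.logb_nonneg one_lt_two h1
  refine ⟨1 + ⌈x⌉₊, by omega, ?_, ?_⟩
  · have h2 : (2 : ℝ) ^ x = 1 / δ := Real.rpow_logb two_pos (by norm_num) (by positivity)
    have h3 : (2 : ℝ) ^ x ≤ 2 ^ ⌈x⌉₊ := by
      rw [← Real.rpow_natCast]
      exact Real.rpow_le_rpow_of_exponent_le one_le_two (Nat.le_ceil x)
    rw [h2] at h3
    rw [pow_add, pow_one]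
    calc 2 / δ = 2 * (1 / δ) := by ring
      _ ≤ _ := by gcongr
  · have h2 := Real.log_le_rpow_div (by positivity : 0 ≤ 1 / δ) ha
    have h3 : (1 / δ) ^ a = δ ^ (-a) := by
      rw [one_div, Real.inv_rpow hδ.le, Real.rpow_neg hδ.le]
    have h4 : x ≤ 2 * Real.log (1 / δ) := by
      rw [hx, Real.logb, div_le_iff₀ (Real.log_pos one_lt_two)]
      nlinarith [Real.log_two_gt_d9, Real.log_nonneg h1]
    have h5 : 1 ≤ δ ^ (-a) := Real.one_le_rpow_of_pos_of_le_one_of_nonpos hδ hδ1 (by linarith)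
    have h6 := (Nat.ceil_lt_add_one hx0).le
    rw [h3] at h2
    push_cast
    calc (1 + ⌈x⌉₊ : ℝ) ≤ 2 * 1 + 2 * (δ ^ (-a) / a) := by linarith
      _ ≤ 2 * δ ^ (-a) + 2 * (δ ^ (-a) / a) := by gcongr
      _ = _ := by ring

lemma abs_curve_le_of_norm_piProj_le {t r δ : ℝ} {w w' : E3}
    (h : ‖piProj t r w' - piProj t r w‖ ≤ δ) :
    |curve (w - w') r| ≤ exp (-t) * δ ∧ |curveDeriv (w - w') r| ≤ δ := by
  have h0 := (PiLp.norm_apply_le (piProj t r w' - piProj t r w) 0).trans h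
  have h1 := (PiLp.norm_apply_le (piProj t r w' - piProj t r w) 1).trans h
  have e0 : (piProj t r w' - piProj t r w) 0 = -(exp t * curve (w - w') r) := by
    simp [piProj, curve]; ring
  have e1 : (piProj t r w' - piProj t r w) 1 = -curveDeriv (w - w') r := by
    simp [piProj, curveDeriv]; ring
  rw [e0, norm_neg, Real.norm_eq_abs, abs_mul, abs_of_pos (exp_pos t)] at h0
  rw [e1, norm_neg, Real.norm_eq_abs] at h1
  refine ⟨?_, h1⟩
  rw [Real.exp_neg, inv_mul_eq_div, le_div_iff₀ (exp_pos t)]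
  linarith

section Mass

open Finset Classical

lemma mass_eq {V : Type*} (F : Finset V) (S : Set V) :
    mass F S = (#{b ∈ F | b ∈ S} : ℝ) / #F := by
  rw [mass]
  congr 2
  have : S ∩ (F : Set V) = (({b ∈ F | b ∈ S} : Finset V) : Set V) := by
    ext b; simp [and_comm]
  rw [this, Nat.card_coe_set_eq, Set.ncard_coe_finset]

lemma mass_le {V : Type*} {F : Finset V} {S : Set V} {p : V → Prop} [DecidablePred p]
    {x : ℝ} (hne : F.Nonempty)
    (hp : ∀ b ∈ F, b ∈ S → p b) (hx : (#{b ∈ F | p b} : ℝ) ≤ #F * x) : mass F S ≤ x := by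
  rw [mass_eq, div_le_iff₀ (by exact_mod_cast hne.card_pos), mul_comm]
  refine le_trans (Nat.cast_le.2 (card_le_card fun b hb => ?_)) hx
  obtain ⟨h1, h2⟩ := mem_filter.1 hb
  exact mem_filter.2 ⟨h1, hp b h1 h2⟩

lemma ballBound_of_mass {F : Finset E3} {C₀ α δ₀ : ℝ} (hne : F.Nonempty)
    (h : ∀ (w : E3) (δ : ℝ), δ₀ ≤ δ → mass F (closedBall w δ) ≤ C₀ * δ ^ α) :
    BallBound F (#F * C₀) α δ₀ := by
  intro w R hR
  have h1 := h w R hR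
  have hN : (0 : ℝ) < #F := by exact_mod_cast hne.card_pos
  rw [mass_eq, div_le_iff₀ hN] at h1
  simp only [mem_closedBall] at h1
  linarith

lemma exists_exceptional {F : Finset E3} {A α δ₀ ε t δ D : ℝ} (hF : BallBound F A α δ₀)
    (hne : F.Nonempty) (hF1 : ∀ w ∈ F, ‖w‖ ≤ 1) (hα : 1 ≤ α) (hα' : α ≤ 3 / 2) (hA : 0 < A)
    (hδ₀ : 0 < δ₀) (ht : 0 ≤ t) (hδ : exp t * δ₀ ≤ δ) (hδ1 : δ ≤ 1) (hε : 0 < ε)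
    (hD : D = 4 * 10 ^ 11 * (2 + 2 / (ε / 64)) ^ 4) :
    ∃ bad : E3 → Set ℝ,
      (∀ w, ∀ r ∈ Set.Icc (0 : ℝ) 1, r ∉ bad w →
        (#{b ∈ F | |curve (w - b) r| ≤ exp (-t) * δ ∧ |curveDeriv (w - b) r| ≤ δ} : ℝ) ≤
          D * A * exp (-t / 10) * δ ^ (α - ε)) ∧
      volume {r | #F * (D * δ ^ (1 / 32 * ε)) < #{w ∈ F | r ∈ bad w}} ≤
        ENNReal.ofReal (D * δ ^ (1 / 32 * ε)) := by
  have hδ0 : 0 < δ := (by positivity : 0 < exp t * δ₀).trans_le hδ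
  obtain ⟨ℓ, hℓ, hδℓ, hℓδ⟩ := exists_two_div_le_two_pow (by positivity : 0 < ε / 64) hδ0 hδ1
  obtain ⟨m, hm0, hm, hmsum⟩ := exists_volume_close_le hF hne hF1 hα hα' hA hδ₀ ht hδ hδ1 hε hℓ hδℓ
  set H := 2 + 2 / (ε / 64) with hH
  have hH2 : 2 ≤ H := by rw [hH]; linarith [(by positivity : 0 ≤ 2 / (ε / 64))]
  have hD1 : 4 * 10 ^ 11 ≤ D := by
    rw [hD]
    exact le_mul_of_one_le_right (by norm_num) (one_le_pow₀ (by linarith))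
  have hDH : 2 * H ≤ D := by
    have : H ≤ H ^ 4 := le_self_pow₀ (by linarith) (by norm_num)
    rw [hD]
    linarith
  have hD0 : 0 < D := by linarith
  have hN : (0 : ℝ) < #F := by exact_mod_cast hne.card_pos
  have hℓ' : (1 : ℝ) ≤ ℓ := by exact_mod_cast hℓ
  refine ⟨_, fun w r hr hrw => ?_, (volume_lt_card_le F _ (fun w _ => hm0 w) hm (by positivity)).trans
    (ENNReal.ofReal_le_ofReal ?_)⟩
  · have h1 := not_lt.1 fun h => hrw ⟨hr, h⟩
    have h2 : δ ^ (-(ε / 64)) ≤ δ ^ (-(ε / 2)) :=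
      Real.rpow_le_rpow_of_exponent_ge hδ0 hδ1 (by linarith)
    have h3 : δ ^ (α - ε) = δ ^ (-(ε / 2)) * δ ^ (α - ε / 2) := by
      rw [← Real.rpow_add hδ0]; congr 1; ring
    calc _ ≤ _ := h1
      _ ≤ (2 * (H * δ ^ (-(ε / 2)))) * (A * δ ^ (α - ε / 2) * exp (-t / 10)) := by
          gcongr
          calc (1 + ℓ : ℝ) ≤ 2 * ℓ := by linarith
            _ ≤ 2 * (H * δ ^ (-(ε / 64))) := by gcongr
            _ ≤ _ := by gcongr
      _ = 2 * H * (A * exp (-t / 10) * δ ^ (α - ε)) := by rw [h3]; ring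
      _ ≤ D * (A * exp (-t / 10) * δ ^ (α - ε)) := by gcongr
      _ = _ := by ring
  · rw [div_le_iff₀ (by positivity)]
    have h1 : (δ ^ (-(ε / 64))) ^ 4 * δ ^ (ε / 8) = δ ^ (1 / 32 * ε) * δ ^ (1 / 32 * ε) := by
      rw [← Real.rpow_mul_natCast hδ0.le, ← Real.rpow_add hδ0, ← Real.rpow_add hδ0]
      congr 1; push_cast; ring
    calc _ ≤ 4 * 10 ^ 11 * #F * ((H * δ ^ (-(ε / 64))) ^ 4 * δ ^ (ε / 8)) :=
          hmsum.trans (by gcongr)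
      _ = D * 1 * #F * ((δ ^ (-(ε / 64))) ^ 4 * δ ^ (ε / 8)) := by rw [hD]; ring
      _ ≤ D * D * #F * ((δ ^ (-(ε / 64))) ^ 4 * δ ^ (ε / 8)) := by gcongr; linarith
      _ = _ := by rw [h1]; ring

end Mass

theorem stmt0 :
    ∀ ε : ℝ, 0 < ε →
    ∃ D c : ℝ, 1 ≤ D ∧ 0 < c ∧
      ∀ (α δ₀ C₀ : ℝ) (F : Finset E3),
        1 ≤ α → α ≤ 3 / 2 → 0 < δ₀ → δ₀ ≤ 1 → 1 ≤ C₀ → F.Nonempty →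
        (F : Set E3) ⊆ closedBall 0 1 →
        (∀ (w : E3) (δ : ℝ), δ₀ ≤ δ → mass F (closedBall w δ) ≤ C₀ * δ ^ α) →
        ε < α / 100 →
        ∀ t δ : ℝ, 0 ≤ t → Real.exp t * δ₀ ≤ δ → δ ≤ 1 →
          ∃ 𝓔 : Set ℝ, 𝓔 ⊆ Set.Icc 0 1 ∧
            volume 𝓔 ≤ ENNReal.ofReal (D * δ ^ (c * ε)) ∧
            ∀ r ∈ Set.Icc (0 : ℝ) 1 \ 𝓔,
              ∃ F' : Finset E3, F' ⊆ F ∧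
                mass F ((F : Set E3) \ (F' : Set E3)) ≤ D * δ ^ (c * ε) ∧
                ∀ w ∈ F',
                  mass F {w' | w' ∈ F' ∧ ‖piProj t r w' - piProj t r w‖ ≤ δ} ≤
                    D * C₀ * Real.exp (-t / 10) * δ ^ (α - ε) := by
  classical
  intro ε hε
  have hH : 1 ≤ (2 + 2 / (ε / 64)) ^ 4 :=
    one_le_pow₀ (by linarith [(by positivity : 0 ≤ 2 / (ε / 64))])
  refine ⟨4 * 10 ^ 11 * (2 + 2 / (ε / 64)) ^ 4, 1 / 32, by linarith, by norm_num, ?_⟩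
  intro α δ₀ C₀ F hα hα' hδ₀ _ hC₀ hne hF hmass _ t δ ht hδ hδ1
  have hN : (0 : ℝ) < F.card := by exact_mod_cast hne.card_pos
  obtain ⟨bad, hgood, hbad⟩ := exists_exceptional (ballBound_of_mass hne hmass) hne
    (fun w hw => by simpa using hF hw) hα hα' (by positivity) hδ₀ ht hδ hδ1 hε rfl
  set D := 4 * 10 ^ 11 * (2 + 2 / (ε / 64)) ^ 4
  refine ⟨Set.Icc 0 1 ∩ {r | F.card * (D * δ ^ (1 / 32 * ε)) < (F.filter (r ∈ bad ·)).card},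
    Set.inter_subset_left, (measure_mono Set.inter_subset_right).trans ?_, ?_⟩
  · convert hbad
  rintro r ⟨hr, hr'⟩
  refine ⟨F.filter (r ∉ bad ·), Finset.filter_subset _ _, ?_, fun w hw => ?_⟩
  · refine mass_le (p := (r ∈ bad ·)) hne (fun b hbF hb => ?_) ?_
    · by_contra h
      exact hb.2 (Finset.mem_coe.2 (Finset.mem_filter.2 ⟨hbF, h⟩))
    · exact not_lt.1 fun h => hr' ⟨hr, h⟩
  · refine mass_le hne (fun b _ hb => abs_curve_le_of_norm_piProj_le hb.2) ?_
    refine (hgood w r hr (Finset.mem_filter.1 hw).2).trans_eq ?_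
    ring
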